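/- arXiv:0806.0151 — 3 statements merged into one kernel-verified Lean document; each statement's English description precedes it below -/
import Mathlib

section
/- Let (Ω, F, p) be a probability space and M : Ω → M_d(ℂ) a random reduced dynamics operator with fixed invariant unit vector ψ_S. Suppose p({ω : M(ω) ∈ ℳ_(E)}) > 0. Then there exist constants C > 0 and α > 0, a set Ω_1 ⊆ Ω^{ℕ*} with ℙ(Ω_1) = 1, and a random variable n_0 : Ω^{ℕ*} → ℕ with E[e^{α n_0}] < ∞, such that for every ω̄ = (ω_1, ω_2, …) ∈ Ω_1 and every n ≥ n_0(ω̄), ‖M_Q(ω_1) M_Q(ω_2) ⋯ M_Q(ω_n)‖ ≤ C e^{−α n}, where ‖·‖ is the Euclidean operator norm. -/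
open scoped BigOperators
open MeasureTheory Filter ContinuousLinearMap

noncomputable section

abbrev Evec (d : ℕ) := EuclideanSpace ℂ (Fin d)
abbrev Op (d : ℕ) := Evec d →L[ℂ] Evec d

/-- `ketBra u v = |u⟩⟨v|`, the rank-one operator `x ↦ ⟪v, x⟫ • u`. -/
def ketBra {d : ℕ} (u v : Evec d) : Op d := (innerSL ℂ v).smulRight u

/-- The spectral projection for the eigenvalue `1`, as the limit of Cesàro averages. -/
def cesaroProj {d : ℕ} (A : Op d) : Op d :=
  limUnder atTop (fun N : ℕ => (N : ℂ)⁻¹ • ∑ k ∈ Finset.range N, A ^ k)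

/-- The class `ℳ_(E)`. -/
def mcalE {d : ℕ} (ψS : Evec d) (A : Op d) : Prop :=
  (∃ Nrm : Seminorm ℂ (Evec d), (∀ x, Nrm x = 0 → x = 0) ∧ ∀ x, Nrm (A x) ≤ Nrm x) ∧
  A ψS = ψS ∧
  spectrum ℂ A ∩ {z : ℂ | ‖z‖ = 1} = {1} ∧
  Module.finrank ℂ (Module.End.maxGenEigenspace (A : Evec d →ₗ[ℂ] Evec d) 1) = 1

/-- `ψ(ω) = P₁(ω)* ψ_S`. -/
def psiOf {d : ℕ} (ψS : Evec d) (A : Op d) : Evec d := adjoint (cesaroProj A) ψS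

/-- `Q(ω) = 1 - |ψ_S⟩⟨ψ(ω)|`. -/
def Qof {d : ℕ} (ψS : Evec d) (A : Op d) : Op d := 1 - ketBra ψS (psiOf ψS A)

/-- `M_Q(ω) = Q(ω) M(ω) Q(ω)`. -/
def MQof {d : ℕ} (ψS : Evec d) (A : Op d) : Op d := Qof ψS A * A * Qof ψS A

open scoped ENNReal NNReal Topology
open ProbabilityTheory

section PrefixProd

/-- The ordered product `f 0 * f 1 * ⋯ * f (n - 1)`. -/
def prefixProd {R : Type*} [Monoid R] (f : ℕ → R) (n : ℕ) : R :=
  (List.ofFn fun i : Fin n => f i).prod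

variable {R : Type*} [Monoid R]

lemma prefixProd_zero (f : ℕ → R) : prefixProd f 0 = 1 := by simp [prefixProd]

lemma prefixProd_succ (f : ℕ → R) (n : ℕ) : prefixProd f (n + 1) = prefixProd f n * f n := by
  rw [prefixProd, List.ofFn_succ']
  simp [prefixProd]

lemma prefixProd_add (f : ℕ → R) (m n : ℕ) :
    prefixProd f (m + n) = prefixProd f m * prefixProd (fun i => f (m + i)) n := by
  induction n with
  | zero => simp [prefixProd_zero]
  | succ n ih => rw [← add_assoc, prefixProd_succ, ih, prefixProd_succ, mul_assoc]

lemma prefixProd_const (a : R) (n : ℕ) : prefixProd (fun _ => a) n = a ^ n := by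
  simp [prefixProd]

/-- Products of `n` factors close to `a` are close to `a ^ n`. -/
lemma exists_open_prefixProd_mem [TopologicalSpace R] [ContinuousMul R] (a : R) (n : ℕ)
    {V : Set R} (hV : V ∈ 𝓝 (a ^ n)) :
    ∃ U : Set R, IsOpen U ∧ a ∈ U ∧
      ∀ f : ℕ → R, (∀ i < n, f i ∈ U) → prefixProd f n ∈ V := by
  induction n generalizing V with
  | zero =>
    refine ⟨Set.univ, isOpen_univ, Set.mem_univ _, fun f _ => ?_⟩
    rw [prefixProd_zero]
    simpa using mem_of_mem_nhds hV
  | succ n ih =>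
    rw [pow_succ] at hV
    have hc : Tendsto (fun x : R × R => x.1 * x.2) (𝓝 (a ^ n) ×ˢ 𝓝 a) (𝓝 (a ^ n * a)) := by
      rw [← nhds_prod_eq]
      exact tendsto_mul
    obtain ⟨s, hs, t, ht, hst⟩ := Filter.mem_prod_iff.1 (hc hV)
    obtain ⟨U, hUo, haU, hU⟩ := ih hs
    obtain ⟨T, hTt, hTo, haT⟩ := mem_nhds_iff.1 ht
    refine ⟨U ∩ T, hUo.inter hTo, ⟨haU, haT⟩, fun f hf => ?_⟩
    rw [prefixProd_succ]
    exact hst (Set.mk_mem_prod (hU f fun i hi => (hf i (hi.trans n.lt_succ_self)).1)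
      (hTt (hf n n.lt_succ_self).2))

end PrefixProd

section Norms

variable {d : ℕ}

lemma Seminorm.exists_le_mul_norm (N : Seminorm ℂ (Evec d)) :
    ∃ b : ℝ, 0 < b ∧ ∀ x, N x ≤ b * ‖x‖ := by
  let e := EuclideanSpace.basisFun (Fin d) ℂ
  refine ⟨∑ i, N (e i) + 1, by positivity, fun x => ?_⟩
  have hx : N x ≤ ∑ i, N (e.repr x i • e i) := by
    conv_lhs => rw [← e.sum_repr x]
    exact Finset.le_sum_of_subadditive N (map_zero N).le (map_add_le_add N) _ _
  calc N x ≤ ∑ i, N (e.repr x i • e i) := hx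
    _ ≤ ∑ i, N (e i) * ‖x‖ := by
      refine Finset.sum_le_sum fun i _ => ?_
      rw [map_smul_eq_mul, mul_comm]
      have : ‖e.repr x i‖ ≤ ‖x‖ := by
        simpa using PiLp.norm_apply_le (e.repr x) i
      gcongr
    _ ≤ (∑ i, N (e i) + 1) * ‖x‖ := by
      rw [← Finset.sum_mul]
      gcongr
      linarith

lemma Seminorm.exists_norm_le_mul (N : Seminorm ℂ (Evec d)) (hN : ∀ x, N x = 0 → x = 0) :
    ∃ a : ℝ, 0 < a ∧ ∀ x, ‖x‖ ≤ a * N x := by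
  obtain ⟨b, hb, hNb⟩ := N.exists_le_mul_norm
  have hcont : Continuous N := by
    refine (LipschitzWith.of_le_add_mul ⟨b, hb.le⟩ fun x y => ?_).continuous
    rw [dist_eq_norm]
    calc N x = N (y + (x - y)) := by simp
      _ ≤ N y + N (x - y) := map_add_le_add N _ _
      _ ≤ N y + b * ‖x - y‖ := by gcongr; exact hNb _
  rcases (Metric.sphere (0 : Evec d) 1).eq_empty_or_nonempty with hS | hS
  · refine ⟨1, one_pos, fun x => ?_⟩
    have hx : x = 0 := by
      by_contra hx
      have : (‖x‖⁻¹ : ℂ) • x ∈ Metric.sphere (0 : Evec d) 1 := by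
        simp [norm_smul, hx]
      simp [hS] at this
    simp [hx]
  · obtain ⟨u, hu, hmin⟩ := (isCompact_sphere (0 : Evec d) 1).exists_isMinOn hS
      hcont.continuousOn
    have hu1 : ‖u‖ = 1 := by simpa using hu
    have hpos : 0 < N u := (apply_nonneg N u).lt_of_ne fun h => by
      have := hN u h.symm
      simp [this] at hu1
    refine ⟨(N u)⁻¹, inv_pos.2 hpos, fun x => ?_⟩
    by_cases hx : x = 0
    · simp [hx]
    have hxs : (‖x‖⁻¹ : ℂ) • x ∈ Metric.sphere (0 : Evec d) 1 := by
      simp [norm_smul, hx]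
    have h := isMinOn_iff.1 hmin _ hxs
    rw [map_smul_eq_mul] at h
    have hxn : 0 < ‖x‖ := norm_pos_iff.2 hx
    have h' : N u ≤ ‖x‖⁻¹ * N x := by simpa using h
    rw [inv_mul_eq_div, le_div_iff₀ hxn] at h'
    rw [inv_mul_eq_div, le_div_iff₀ hpos]
    linarith

lemma prefixProd_seminorm_le {N : Seminorm ℂ (Evec d)} {f : ℕ → Op d}
    (hf : ∀ i x, N (f i x) ≤ N x) (n : ℕ) (x : Evec d) : N (prefixProd f n x) ≤ N x := by
  induction n generalizing x with
  | zero => simp [prefixProd_zero]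
  | succ n ih =>
    rw [prefixProd_succ]
    exact (ih _).trans (hf n x)

lemma prefixProd_apply_fixed {f : ℕ → Op d} {v : Evec d} (hf : ∀ i, f i v = v) (n : ℕ) :
    prefixProd f n v = v := by
  induction n with
  | zero => simp [prefixProd_zero]
  | succ n ih => rw [prefixProd_succ, mul_apply_eq_comp, hf, ih]

lemma pow_apply_fixed {A : Op d} {v : Evec d} (hA : A v = v) (n : ℕ) : (A ^ n) v = v := by
  rw [← prefixProd_const]
  exact prefixProd_apply_fixed (fun _ => hA) n

/-- Power-boundedness of a contraction for some norm. -/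
lemma norm_pow_le_of_seminorm_contraction {N : Seminorm ℂ (Evec d)} {a b : ℝ} (ha : 0 < a)
    (hb : 0 < b) (hNa : ∀ x, ‖x‖ ≤ a * N x) (hNb : ∀ x, N x ≤ b * ‖x‖) {A : Op d}
    (hA : ∀ x, N (A x) ≤ N x) (n : ℕ) : ‖A ^ n‖ ≤ a * b := by
  refine ContinuousLinearMap.opNorm_le_bound _ (by positivity) fun x => ?_
  have h := prefixProd_seminorm_le (f := fun _ => A) (fun _ => hA) n x
  rw [prefixProd_const] at h
  calc ‖(A ^ n) x‖ ≤ a * N ((A ^ n) x) := hNa _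
    _ ≤ a * (b * ‖x‖) := by gcongr; exact h.trans (hNb x)
    _ = a * b * ‖x‖ := by ring

end Norms

section MeanErgodic

variable {d : ℕ}

/-- The Cesàro average of the first `N` powers of `A`. -/
def cesaroMean (A : Op d) (N : ℕ) : Op d := (N : ℂ)⁻¹ • ∑ k ∈ Finset.range N, A ^ k

lemma norm_cesaroMean_le {A : Op d} {D : ℝ} (hD : ∀ n, ‖A ^ n‖ ≤ D) (N : ℕ) :
    ‖cesaroMean A N‖ ≤ D := by
  have hD0 : 0 ≤ D := (norm_nonneg _).trans (hD 0)
  rcases Nat.eq_zero_or_pos N with rfl | hN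
  · simpa [cesaroMean] using hD0
  have hN' : (0 : ℝ) < N := by exact_mod_cast hN
  rw [cesaroMean, norm_smul, norm_inv, Complex.norm_natCast, inv_mul_le_iff₀ hN']
  calc ‖∑ k ∈ Finset.range N, A ^ k‖ ≤ ∑ k ∈ Finset.range N, D :=
        norm_sum_le_of_le _ fun k _ => hD k
    _ = N * D := by simp

lemma commute_cesaroMean (A : Op d) (N : ℕ) : Commute A (cesaroMean A N) :=
  (Commute.sum_right _ _ _ fun k _ => (Commute.refl A).pow_right k).smul_right _

lemma tendsto_cesaroMean_mul_sub {A : Op d} {D : ℝ} (hD : ∀ n, ‖A ^ n‖ ≤ D) :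
    Tendsto (fun N => cesaroMean A N * (A - 1)) atTop (𝓝 0) := by
  have h : ∀ N, ‖cesaroMean A N * (A - 1)‖ ≤ (2 * D) * (N : ℝ)⁻¹ := fun N => by
    rw [cesaroMean, smul_mul_assoc, geom_sum_mul, norm_smul, norm_inv, Complex.norm_natCast,
      mul_comm]
    gcongr
    calc ‖A ^ N - 1‖ ≤ ‖A ^ N‖ + ‖A ^ 0‖ := by simpa using norm_sub_le (A ^ N) 1
      _ ≤ 2 * D := by linarith [hD N, hD 0]
  refine squeeze_zero_norm h ?_
  simpa using (tendsto_inv_atTop_nhds_zero_nat (𝕜 := ℝ)).const_mul (2 * D)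

/-- The mean ergodic theorem for power-bounded operators in finite dimension. -/
lemma exists_tendsto_cesaroMean {A : Op d} {D : ℝ} (hD : ∀ n, ‖A ^ n‖ ≤ D) :
    ∃ P : Op d, Tendsto (cesaroMean A) atTop (𝓝 P) := by
  have hmem : ∀ N, cesaroMean A N ∈ Metric.closedBall (0 : Op d) D := fun N => by
    simpa using norm_cesaroMean_le hD N
  have hcpt : IsCompact (Metric.closedBall (0 : Op d) D) := isCompact_closedBall _ _
  have hinv : ∀ P, MapClusterPt P atTop (cesaroMean A) → P * A = P ∧ A * P = P := by
    intro P hP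
    have h1 : MapClusterPt (P * (A - 1)) atTop (fun N => cesaroMean A N * (A - 1)) :=
      hP.continuousAt_comp (f := fun X => X * (A - 1)) (by fun_prop)
    have h2 : MapClusterPt ((A - 1) * P) atTop (fun N => cesaroMean A N * (A - 1)) := by
      have : (fun N => cesaroMean A N * (A - 1)) = fun N => (A - 1) * cesaroMean A N := by
        funext N
        exact (((commute_cesaroMean A N).sub_left (Commute.one_left _)).eq).symm
      rw [this]
      exact hP.continuousAt_comp (f := fun X => (A - 1) * X) (by fun_prop)
    have h0 := tendsto_cesaroMean_mul_sub hD
    have e1 : P * (A - 1) = 0 := eq_of_nhds_neBot (h1.neBot.mono (inf_le_inf_left _ h0))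
    have e2 : (A - 1) * P = 0 := eq_of_nhds_neBot (h2.neBot.mono (inf_le_inf_left _ h0))
    rw [mul_sub, mul_one, sub_eq_zero] at e1
    rw [sub_mul, one_mul, sub_eq_zero] at e2
    exact ⟨e1, e2⟩
  have hpow : ∀ P : Op d, P * A = P → ∀ N : ℕ, 0 < N → P * cesaroMean A N = P := by
    intro P hP N hN
    have hk : ∀ k, P * A ^ k = P := fun k => by
      induction k with
      | zero => simp
      | succ k ih => rw [pow_succ, ← mul_assoc, ih, hP]
    have : (N : ℂ) ≠ 0 := by exact_mod_cast hN.ne'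
    rw [cesaroMean, mul_smul_comm, Finset.mul_sum, Finset.sum_congr rfl fun k _ => hk k,
      Finset.sum_const, Finset.card_range, ← Nat.cast_smul_eq_nsmul ℂ, inv_smul_smul₀ this]
  have hpow' : ∀ P : Op d, A * P = P → ∀ N : ℕ, 0 < N → cesaroMean A N * P = P := by
    intro P hP N hN
    have hk : ∀ k, A ^ k * P = P := fun k => by
      induction k with
      | zero => simp
      | succ k ih => rw [pow_succ, mul_assoc, hP, ih]
    have : (N : ℂ) ≠ 0 := by exact_mod_cast hN.ne'
    rw [cesaroMean, smul_mul_assoc, Finset.sum_mul, Finset.sum_congr rfl fun k _ => hk k,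
      Finset.sum_const, Finset.card_range, ← Nat.cast_smul_eq_nsmul ℂ, inv_smul_smul₀ this]
  obtain ⟨P, -, hP⟩ := hcpt.exists_mapClusterPt (u := cesaroMean A) (f := atTop)
    (le_principal_iff.2 (Filter.mem_map.2 (Filter.univ_mem' hmem)))
  refine ⟨P, hcpt.tendsto_nhds_of_unique_mapClusterPt (Eventually.of_forall hmem)
    fun P' _ hP' => ?_⟩
  have e1 : P * P' = P := by
    have h := hP'.continuousAt_comp (f := fun X => P * X) (by fun_prop)
    refine eq_of_nhds_neBot (h.neBot.mono (inf_le_inf_left _ ?_))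
    exact tendsto_const_nhds.congr' ((eventually_gt_atTop 0).mono fun N hN =>
      (hpow P (hinv P hP).1 N hN).symm)
  have e2 : P * P' = P' := by
    have h := hP.continuousAt_comp (f := fun X => X * P') (by fun_prop)
    refine eq_of_nhds_neBot (h.neBot.mono (inf_le_inf_left _ ?_))
    exact tendsto_const_nhds.congr' ((eventually_gt_atTop 0).mono fun N hN =>
      (hpow' P' (hinv P' hP').2 N hN).symm)
  exact e2.symm.trans e1

lemma tendsto_cesaroProj {A : Op d} {D : ℝ} (hD : ∀ n, ‖A ^ n‖ ≤ D) :
    Tendsto (cesaroMean A) atTop (𝓝 (cesaroProj A)) :=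
  tendsto_nhds_limUnder (exists_tendsto_cesaroMean hD)

lemma norm_cesaroProj_le {A : Op d} {D : ℝ} (hD : ∀ n, ‖A ^ n‖ ≤ D) : ‖cesaroProj A‖ ≤ D :=
  le_of_tendsto (tendsto_cesaroProj hD).norm
    (Eventually.of_forall fun N => norm_cesaroMean_le hD N)

lemma cesaroProj_apply_of_fixed {A : Op d} {D : ℝ} (hD : ∀ n, ‖A ^ n‖ ≤ D) {x : Evec d}
    (hx : A x = x) : cesaroProj A x = x := by
  have h : Tendsto (fun N => cesaroMean A N x) atTop (𝓝 (cesaroProj A x)) :=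
    ((ContinuousLinearMap.apply ℂ (Evec d) x).continuous.tendsto _).comp (tendsto_cesaroProj hD)
  refine tendsto_nhds_unique h (tendsto_const_nhds.congr'
    ((eventually_gt_atTop 0).mono fun N hN => ?_))
  have : (N : ℂ) ≠ 0 := by exact_mod_cast hN.ne'
  simp only [cesaroMean, smul_apply, sum_apply, pow_apply_fixed hx,
    Finset.sum_const, Finset.card_range]
  rw [← Nat.cast_smul_eq_nsmul ℂ, inv_smul_smul₀ this]

end MeanErgodic

section RandomReduced

variable {d : ℕ} {ψS : Evec d}

lemma ketBra_apply (u v x : Evec d) : ketBra u v x = inner ℂ v x • u := by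
  simp [ketBra]

lemma norm_ketBra_le (u v : Evec d) : ‖ketBra u v‖ ≤ ‖v‖ * ‖u‖ :=
  ContinuousLinearMap.opNorm_le_bound _ (by positivity) fun x => by
    rw [ketBra_apply, norm_smul]
    calc ‖(inner ℂ v x : ℂ)‖ * ‖u‖ ≤ ‖v‖ * ‖x‖ * ‖u‖ := by gcongr; exact norm_inner_le_norm _ _
      _ = ‖v‖ * ‖u‖ * ‖x‖ := by ring

lemma inner_psiOf (A : Op d) (x : Evec d) :
    inner ℂ (psiOf ψS A) x = inner ℂ ψS (cesaroProj A x) :=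
  ContinuousLinearMap.adjoint_inner_left _ _ _

lemma Qof_apply_fixed (hψS : ‖ψS‖ = 1) {A : Op d} {D : ℝ} (hD : ∀ n, ‖A ^ n‖ ≤ D)
    (hA : A ψS = ψS) : Qof ψS A ψS = 0 := by
  simp [Qof, ketBra_apply, inner_psiOf, cesaroProj_apply_of_fixed hD hA, hψS]

lemma norm_Qof_le (hψS : ‖ψS‖ = 1) {A : Op d} {D : ℝ} (hD : ∀ n, ‖A ^ n‖ ≤ D) :
    ‖Qof ψS A‖ ≤ 1 + D := by
  have h1 : ‖(1 : Op d)‖ ≤ 1 := ContinuousLinearMap.norm_id_le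
  have h2 : ‖psiOf ψS A‖ ≤ D := by
    calc ‖psiOf ψS A‖ ≤ ‖adjoint (cesaroProj A)‖ * ‖ψS‖ := ContinuousLinearMap.le_opNorm _ _
      _ ≤ D := by
        rw [hψS, mul_one, LinearIsometryEquiv.norm_map]
        exact norm_cesaroProj_le hD
  calc ‖Qof ψS A‖ ≤ ‖(1 : Op d)‖ + ‖ketBra ψS (psiOf ψS A)‖ := norm_sub_le _ _
    _ ≤ 1 + D := by
      have := norm_ketBra_le ψS (psiOf ψS A)
      rw [hψS, mul_one] at this
      linarith

lemma MQof_eq (hψS : ‖ψS‖ = 1) {A : Op d} {D : ℝ} (hD : ∀ n, ‖A ^ n‖ ≤ D)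
    (hA : A ψS = ψS) : MQof ψS A = Qof ψS A * A := by
  ext1 x
  have h0 := Qof_apply_fixed hψS hD hA
  have h1 : Qof ψS A x = x - (inner ℂ (psiOf ψS A) x : ℂ) • ψS := by
    simp [Qof, ketBra_apply]
  rw [MQof, mul_apply_eq_comp, h1, map_sub, map_smul, mul_apply_eq_comp,
    mul_apply_eq_comp, hA, h0, smul_zero, sub_zero]

/-- `M_Q(ω₁) ⋯ M_Q(ωₙ) = Q(ω₁) M(ω₁) ⋯ M(ωₙ)`. -/
lemma prefixProd_MQof (hψS : ‖ψS‖ = 1) {f : ℕ → Op d} {D : ℝ} (hD : ∀ i n, ‖f i ^ n‖ ≤ D)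
    (hf : ∀ i, f i ψS = ψS) (n : ℕ) :
    prefixProd (fun i => MQof ψS (f i)) (n + 1) = Qof ψS (f 0) * prefixProd f (n + 1) := by
  induction n with
  | zero => simp [prefixProd_succ, prefixProd_zero, MQof_eq hψS (hD 0) (hf 0)]
  | succ n ih =>
    rw [prefixProd_succ, ih, prefixProd_succ f (n + 1), ← mul_assoc]
    ext1 x
    have h1 : ∀ y, MQof ψS (f (n + 1)) y =
        f (n + 1) y - (inner ℂ (psiOf ψS (f (n + 1))) (f (n + 1) y) : ℂ) • ψS := fun y => by
      rw [MQof_eq hψS (hD _) (hf _)]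
      simp [Qof, ketBra_apply]
    simp only [mul_apply_eq_comp, h1, map_sub, map_smul,
      prefixProd_apply_fixed hf,
      Qof_apply_fixed hψS (hD 0) (hf 0), smul_zero, sub_zero]

end RandomReduced

section SpectralGap

variable {d : ℕ} {ψS : Evec d}

lemma tendsto_pow_of_spectralRadius_lt_one {R : Type*} [NormedRing R] [NormedAlgebra ℂ R]
    [CompleteSpace R] {a : R} (ha : spectralRadius ℂ a < 1) :
    Tendsto (fun n : ℕ => a ^ n) atTop (𝓝 0) := by
  obtain ⟨r, har, hr1⟩ := ENNReal.lt_iff_exists_nnreal_btwn.1 ha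
  have hr : r < 1 := by exact_mod_cast hr1
  have hev := (spectrum.pow_nnnorm_pow_one_div_tendsto_nhds_spectralRadius a).eventually
    (gt_mem_nhds har)
  refine squeeze_zero_norm' ?_ (tendsto_pow_atTop_nhds_zero_of_lt_one r.2 (by exact_mod_cast hr))
  filter_upwards [hev, eventually_gt_atTop 0] with n hn hn0
  have hn' : (0 : ℝ) < n := by exact_mod_cast hn0
  have h := ENNReal.rpow_le_rpow hn.le hn'.le
  rw [← ENNReal.rpow_mul, one_div, inv_mul_cancel₀ hn'.ne', ENNReal.rpow_one,
    ENNReal.rpow_natCast] at h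
  exact_mod_cast h

/-- The orthogonal projection killing `ψS`. -/
def orthProj (ψS : Evec d) : Op d := 1 - ketBra ψS ψS

lemma orthProj_apply (x : Evec d) : orthProj ψS x = x - (inner ℂ ψS x : ℂ) • ψS := by
  simp [orthProj, ketBra_apply]

lemma orthProj_apply_self (hψS : ‖ψS‖ = 1) : orthProj ψS ψS = 0 := by
  simp [orthProj_apply, hψS]

lemma orthProj_mul_pow (hψS : ‖ψS‖ = 1) {A : Op d} (hA : A ψS = ψS) (n : ℕ) :
    (orthProj ψS * A) ^ (n + 1) = orthProj ψS * A ^ (n + 1) := by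
  induction n with
  | zero => simp
  | succ n ih =>
    rw [pow_succ, ih]
    ext1 x
    rw [pow_succ A (n + 1)]
    simp only [mul_apply_eq_comp]
    rw [orthProj_apply (A x), map_sub, map_smul, pow_apply_fixed hA, map_sub, map_smul,
      orthProj_apply_self hψS, smul_zero, sub_zero]

lemma norm_lt_one_of_mem_spectrum_orthProj_mul (hψS : ‖ψS‖ = 1) {A : Op d} (hA : mcalE ψS A)
    {z : ℂ} (hz : z ∈ spectrum ℂ (orthProj ψS * A)) : ‖z‖ < 1 := by
  obtain ⟨⟨N, hN0, hN⟩, hfix, hspec, hsimple⟩ := hA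
  have hψ0 : ψS ≠ 0 := by rintro rfl; simp at hψS
  by_contra! hz1
  have hzne : z ≠ 0 := by rintro rfl; simp at hz1; linarith
  rw [ContinuousLinearMap.spectrum_eq, ← Module.End.hasEigenvalue_iff_mem_spectrum] at hz
  obtain ⟨x, hx⟩ := hz.exists_hasEigenvector
  have hx0 : x ≠ 0 := hx.2
  have hxe : orthProj ψS (A x) = z • x := hx.apply_eq_smul
  -- `x` is orthogonal to `ψS`
  have horth : (inner ℂ ψS x : ℂ) = 0 := by
    have : (inner ℂ ψS (z • x) : ℂ) = 0 := by
      rw [← hxe, orthProj_apply]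
      simp [hψS]
    rw [inner_smul_right] at this
    exact (mul_eq_zero.1 this).resolve_left hzne
  have hnot : ∀ t : ℂ, x ≠ t • ψS := by
    rintro t rfl
    rw [inner_smul_right, inner_self_eq_norm_sq_to_K, hψS] at horth
    have : t = 0 := by simpa using horth
    simp [this] at hx0
  set c : ℂ := inner ℂ ψS (A x) with hc
  have hAx : A x = z • x + c • ψS := by
    rw [← hxe, orthProj_apply, ← hc]
    simp
  have hz1' : z = 1 := by
    by_contra hne
    have hsub : z - 1 ≠ 0 := sub_ne_zero.2 hne
    set t : ℂ := c / (z - 1) with ht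
    set y : Evec d := x + t • ψS with hy
    have hy0 : y ≠ 0 := fun h => hnot (-t) (by
      rw [neg_smul]; exact eq_neg_of_add_eq_zero_left h)
    have hcz : c = z * t - t := by
      rw [ht]; field_simp
    have hAy : A y = z • y := by
      rw [hy, map_add, map_smul, hfix, hAx, hcz, smul_add, smul_smul, sub_smul]
      abel
    have hmem : z ∈ spectrum ℂ A := by
      rw [ContinuousLinearMap.spectrum_eq, ← Module.End.hasEigenvalue_iff_mem_spectrum]
      exact Module.End.hasEigenvalue_of_hasEigenvector
        ⟨Module.End.mem_eigenspace_iff.2 hAy, hy0⟩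
    have hNy : 0 < N y := (apply_nonneg N y).lt_of_ne fun h => hy0 (hN0 y h.symm)
    have hle := hN y
    rw [hAy, map_smul_eq_mul] at hle
    have hz' : ‖z‖ = 1 := le_antisymm (le_of_mul_le_mul_right (by simpa using hle) hNy) hz1
    have : z ∈ ({1} : Set ℂ) := hspec ▸ ⟨hmem, hz'⟩
    exact hne this
  subst hz1'
  have hmax : ∀ v : Evec d,
      ((A : Evec d →ₗ[ℂ] Evec d) - 1) (((A : Evec d →ₗ[ℂ] Evec d) - 1) v) = 0 →
      v ∈ Module.End.maxGenEigenspace (A : Evec d →ₗ[ℂ] Evec d) 1 := fun v hv => by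
    rw [Module.End.mem_maxGenEigenspace]
    exact ⟨2, by simpa [pow_two] using hv⟩
  have hxm := hmax x (by simp [hAx, hfix])
  have hψm := hmax ψS (by simp [hfix])
  obtain ⟨t, ht⟩ := (finrank_eq_one_iff_of_nonzero'
    (⟨ψS, hψm⟩ : Module.End.maxGenEigenspace (A : Evec d →ₗ[ℂ] Evec d) 1)
    (fun h => hψ0 (congrArg Subtype.val h))).1 hsimple ⟨x, hxm⟩
  exact hnot t (congrArg Subtype.val ht).symm

lemma exists_norm_orthProj_mul_pow_lt (hψS : ‖ψS‖ = 1) {A : Op d} (hA : mcalE ψS A) {ε : ℝ}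
    (hε : 0 < ε) : ∃ k : ℕ, 0 < k ∧ ‖orthProj ψS * A ^ k‖ < ε := by
  have : Nontrivial (Evec d) := ⟨⟨ψS, 0, by rintro rfl; simp at hψS⟩⟩
  have hrad : spectralRadius ℂ (orthProj ψS * A) < 1 := by
    have := spectrum.spectralRadius_lt_of_forall_lt (orthProj ψS * A) (r := 1)
      fun z hz => by
        have := norm_lt_one_of_mem_spectrum_orthProj_mul hψS hA hz
        exact_mod_cast this
    simpa using this
  have h := (tendsto_pow_of_spectralRadius_lt_one hrad).norm
  rw [norm_zero] at h
  obtain ⟨k, hk⟩ := ((tendsto_add_atTop_iff_nat 1).2 h |>.eventually (gt_mem_nhds hε)).exists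
  exact ⟨k + 1, k.succ_pos, by rwa [orthProj_mul_pow hψS hA.2.1] at hk⟩

end SpectralGap

section QuotientNorm

variable {d : ℕ} {ψS : Evec d}

/-- The quotient seminorm of `N` modulo `ψS`. -/
def quotNorm (N : Seminorm ℂ (Evec d)) (ψS x : Evec d) : ℝ := ⨅ c : ℂ, N (x - c • ψS)

variable {N : Seminorm ℂ (Evec d)}

lemma bddBelow_quotNorm (x : Evec d) : BddBelow (Set.range fun c : ℂ => N (x - c • ψS)) :=
  ⟨0, by rintro _ ⟨c, rfl⟩; exact apply_nonneg N _⟩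

lemma quotNorm_apply_le {A : Op d} (hA : ∀ x, N (A x) ≤ N x) (hfix : A ψS = ψS) (x : Evec d) :
    quotNorm N ψS (A x) ≤ quotNorm N ψS x := by
  refine ciInf_mono (bddBelow_quotNorm _) fun c => ?_
  have : A x - c • ψS = A (x - c • ψS) := by simp [hfix]
  rw [this]
  exact hA _

lemma quotNorm_le {b : ℝ} (hb : ∀ x, N x ≤ b * ‖x‖) (x : Evec d) :
    quotNorm N ψS x ≤ b * ‖orthProj ψS x‖ := by
  refine (ciInf_le (bddBelow_quotNorm x) (inner ℂ ψS x)).trans ?_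
  rw [← orthProj_apply]
  exact hb _

/-- Operators killing `ψS` are controlled by the quotient norm. -/
lemma norm_apply_le_quotNorm {a : ℝ} (ha : 0 ≤ a) (hNa : ∀ x, ‖x‖ ≤ a * N x) {B : Op d}
    (hB : B ψS = 0) (x : Evec d) : ‖B x‖ ≤ ‖B‖ * a * quotNorm N ψS x := by
  rw [quotNorm, Real.mul_iInf_of_nonneg (by positivity)]
  refine le_ciInf fun c => ?_
  have : B x = B (x - c • ψS) := by simp [hB]
  rw [this, mul_assoc]
  exact (B.le_opNorm _).trans (by gcongr; exact hNa _)

lemma quotNorm_le_self (x : Evec d) : quotNorm N ψS x ≤ N x :=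
  (ciInf_le (bddBelow_quotNorm x) 0).trans (by simp)

lemma quotNorm_nonneg (x : Evec d) : 0 ≤ quotNorm N ψS x :=
  le_ciInf fun _ => apply_nonneg N _

/-- Operators fixing `ψS` which are small modulo `ψS` contract the quotient norm. -/
lemma quotNorm_apply_le_half (hψS : ‖ψS‖ = 1) {a b : ℝ} (ha : 0 < a) (hb : 0 < b)
    (hNa : ∀ x, ‖x‖ ≤ a * N x) (hNb : ∀ x, N x ≤ b * ‖x‖) {A : Op d} (hfix : A ψS = ψS)
    (hA : ‖orthProj ψS * A‖ ≤ 1 / (2 * a * b)) (x : Evec d) :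
    quotNorm N ψS (A x) ≤ 1 / 2 * quotNorm N ψS x := by
  have hkill : (orthProj ψS * A) ψS = 0 := by
    rw [mul_apply_eq_comp, hfix, orthProj_apply_self hψS]
  have hq := quotNorm_nonneg (N := N) (ψS := ψS) x
  calc quotNorm N ψS (A x) ≤ b * ‖(orthProj ψS * A) x‖ := quotNorm_le hNb _
    _ ≤ b * (‖orthProj ψS * A‖ * a * quotNorm N ψS x) := by
      gcongr; exact norm_apply_le_quotNorm ha.le hNa hkill x
    _ ≤ b * (1 / (2 * a * b) * a * quotNorm N ψS x) := by gcongr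
    _ = 1 / 2 * quotNorm N ψS x := by field_simp

open Classical in
/-- Products over blocks of length `k` contract by `1/2` for every block with all letters in `U`. -/
lemma quotNorm_prefixProd_le {f : ℕ → Op d} (hf : ∀ i x, N (f i x) ≤ N x)
    (hfix : ∀ i, f i ψS = ψS) {k : ℕ} {U : Set (Op d)}
    (hU : ∀ g : ℕ → Op d, (∀ i, g i ψS = ψS) → (∀ i < k, g i ∈ U) →
      ∀ x, quotNorm N ψS (prefixProd g k x) ≤ 1 / 2 * quotNorm N ψS x) (n : ℕ) (x : Evec d) :
    quotNorm N ψS (prefixProd f n x) ≤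
      (∏ j ∈ Finset.range (n / k), if ∀ i < k, f (j * k + i) ∈ U then (1 / 2 : ℝ) else 1) *
        quotNorm N ψS x := by
  have hstep : ∀ g : ℕ → Op d, (∀ i x, N (g i x) ≤ N x) → (∀ i, g i ψS = ψS) → ∀ n x,
      quotNorm N ψS (prefixProd g n x) ≤ quotNorm N ψS x := fun g hg hgf n x => by
    induction n generalizing x with
    | zero => simp [prefixProd_zero]
    | succ n ih =>
      rw [prefixProd_succ]
      exact (ih _).trans (quotNorm_apply_le (hg n) (hgf n) x)
  have hblock : ∀ m x, quotNorm N ψS (prefixProd f (m * k) x) ≤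
      (∏ j ∈ Finset.range m, if ∀ i < k, f (j * k + i) ∈ U then (1 / 2 : ℝ) else 1) *
        quotNorm N ψS x := fun m => by
    induction m with
    | zero => simp [prefixProd_zero]
    | succ m ih =>
      intro x
      rw [add_mul, one_mul, prefixProd_add, mul_apply_eq_comp, Finset.prod_range_succ, mul_assoc]
      refine (ih _).trans ?_
      gcongr
      split_ifs with h
      · exact hU _ (fun i => hfix _) h x
      · rw [one_mul]
        exact hstep _ (fun i => hf _) (fun i => hfix _) _ _
  conv_lhs => rw [← Nat.div_add_mod' n k]
  rw [prefixProd_add, mul_apply_eq_comp]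
  refine (hblock _ _).trans ?_
  gcongr
  exact hstep _ (fun i => hf _) (fun i => hfix _) _ _

end QuotientNorm

section Probability

/-- A sequence whose means decay exponentially decays exponentially almost surely, after a random
time with an exponential moment. -/
lemma exists_random_time_exp_decay {X : Type*} [MeasurableSpace X] (μ : Measure X)
    [IsProbabilityMeasure μ] {r : ℕ → X → ℝ} (hr : ∀ n, Measurable (r n)) {K β : ℝ}
    (hβ : 0 < β)
    (hint : ∀ n : ℕ,
      ∫⁻ x, ENNReal.ofReal (r n x) ∂μ ≤ ENNReal.ofReal (K * Real.exp (-(2 * β) * n))) :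
    ∃ (S : Set X) (n₀ : X → ℕ), μ S = 1 ∧ Measurable n₀ ∧
      Integrable (fun x => Real.exp (β / 2 * n₀ x)) μ ∧
      ∀ x ∈ S, ∀ n : ℕ, n₀ x ≤ n → r n x ≤ Real.exp (-(β / 2) * n) := by
  set Z : X → ℝ≥0∞ := fun x => ∑' n : ℕ, ENNReal.ofReal (Real.exp (β * n) * r n x) with hZ
  have hterm : ∀ n : ℕ, Measurable fun x => ENNReal.ofReal (Real.exp (β * n) * r n x) :=
    fun n => ((hr n).const_mul _).ennreal_ofReal
  have hZm : Measurable Z := Measurable.tsum hterm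
  have hsum : Summable fun n : ℕ => K * Real.exp (-β) ^ n :=
    (summable_geometric_of_lt_one (Real.exp_pos _).le (by simpa using hβ)).mul_left K
  have hZint : ∫⁻ x, Z x ∂μ ≠ ∞ := by
    rw [hZ, lintegral_tsum fun n => (hterm n).aemeasurable]
    refine ne_top_of_le_ne_top hsum.tsum_ofReal_ne_top (ENNReal.tsum_le_tsum fun n => ?_)
    simp_rw [ENNReal.ofReal_mul (Real.exp_pos (β * n)).le]
    rw [lintegral_const_mul _ (hr n).ennreal_ofReal]
    refine (mul_le_mul_right (hint n) _).trans_eq ?_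
    rw [← ENNReal.ofReal_mul (Real.exp_pos _).le, ← Real.exp_nat_mul, mul_left_comm,
      ← Real.exp_add]
    congr 3
    ring
  set Y : X → ℝ := fun x => max (Z x).toReal 1 with hY
  have hYm : Measurable Y := hZm.ennreal_toReal.max measurable_const
  have hY1 : ∀ x, 1 ≤ Y x := fun x => le_max_right _ _
  have hY0 : ∀ x, 0 < Y x := fun x => one_pos.trans_le (hY1 x)
  have hYint : Integrable Y μ :=
    (integrable_toReal_of_lintegral_ne_top hZm.aemeasurable hZint).sup (integrable_const 1)
  set n₀ : X → ℕ := fun x => ⌈2 / β * Real.log (Y x)⌉₊ with hn₀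
  have hn₀m : Measurable n₀ := Nat.measurable_ceil.comp (hYm.log.const_mul _)
  refine ⟨{x | Z x < ∞}, n₀, ?_, hn₀m, ?_, ?_⟩
  · exact (mem_ae_iff_prob_eq_one (hZm measurableSet_Iio)).1 (ae_lt_top hZm hZint)
  · refine (hYint.const_mul (Real.exp (β / 2))).mono' ?_ (Eventually.of_forall fun x => ?_)
    · exact (Real.measurable_exp.comp
        ((measurable_from_nat (f := fun n : ℕ => (n : ℝ))).comp hn₀m
          |>.const_mul _)).aestronglyMeasurable
    · rw [Real.norm_of_nonneg (Real.exp_pos _).le]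
      have hlog : 0 ≤ 2 / β * Real.log (Y x) := mul_nonneg (by positivity) (Real.log_nonneg (hY1 x))
      have hceil : (n₀ x : ℝ) ≤ 2 / β * Real.log (Y x) + 1 := (Nat.ceil_lt_add_one hlog).le
      calc Real.exp (β / 2 * n₀ x) ≤ Real.exp (β / 2 * (2 / β * Real.log (Y x) + 1)) := by gcongr
        _ = Real.exp (β / 2) * Y x := by
          rw [show β / 2 * (2 / β * Real.log (Y x) + 1) = β / 2 + Real.log (Y x) by field_simp; ring,
            Real.exp_add, Real.exp_log (hY0 x)]
  · intro x hx n hn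
    have hle : Real.exp (β * n) * r n x ≤ Y x := by
      have h1 : ENNReal.ofReal (Real.exp (β * n) * r n x) ≤ Z x :=
        ENNReal.le_tsum (f := fun n : ℕ => ENNReal.ofReal (Real.exp (β * n) * r n x)) n
      exact ((ENNReal.ofReal_le_iff_le_toReal (ne_of_lt hx)).1 h1).trans (le_max_left _ _)
    have hYn : Y x ≤ Real.exp (β / 2 * n) := by
      have h2 : 2 / β * Real.log (Y x) ≤ n := (Nat.ceil_le).1 hn
      rw [← Real.log_le_iff_le_exp (hY0 x)]
      calc Real.log (Y x) = β / 2 * (2 / β * Real.log (Y x)) := by field_simp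
        _ ≤ β / 2 * n := by gcongr
    have h3 : Real.exp (β * n) * r n x ≤ Real.exp (β * n) * Real.exp (-(β / 2) * n) := by
      rw [← Real.exp_add]
      refine (hle.trans hYn).trans_eq ?_
      congr 1
      ring
    exact le_of_mul_le_mul_left h3 (Real.exp_pos _)

variable {Ω : Type*} [MeasurableSpace Ω] {p : Measure Ω} [IsProbabilityMeasure p]
  {Pb : Measure (ℕ → Ω)}

lemma measure_forall_mem_finset
    (hPb : ∀ n : ℕ, Pb.map (fun ωb (i : Fin n) => ωb i) = Measure.pi fun _ : Fin n => p)
    {B : Set Ω} (hB : MeasurableSet B) (F : Finset ℕ) :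
    Pb {ωb | ∀ i ∈ F, ωb i ∈ B} = p B ^ F.card := by
  classical
  obtain ⟨n, hn⟩ := F.exists_nat_subset_range
  have hset : {ωb : ℕ → Ω | ∀ i ∈ F, ωb i ∈ B} = (fun ωb (i : Fin n) => ωb i) ⁻¹'
      Set.univ.pi fun i : Fin n => if (i : ℕ) ∈ F then B else Set.univ := by
    ext ωb
    simp only [Set.mem_ofPred_eq, Set.mem_preimage, Set.mem_pi, Set.mem_univ, true_imp_iff]
    refine ⟨fun h i => ?_, fun h i hi => ?_⟩
    · split_ifs with hi
      exacts [h _ hi, Set.mem_univ _]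
    · simpa [hi] using h ⟨i, Finset.mem_range.1 (hn hi)⟩
  rw [hset, ← Measure.map_apply (by fun_prop), hPb, Measure.pi_pi]
  · have : ∀ i : Fin n, p (if (i : ℕ) ∈ F then B else Set.univ) =
        (fun j : ℕ => if j ∈ F then p B else 1) i := fun i => by
      simp only
      split_ifs <;> simp
    rw [Finset.prod_congr rfl fun i _ => this i,
      Fin.prod_univ_eq_prod_range (fun j : ℕ => if j ∈ F then p B else 1) n,
      Finset.prod_ite_mem, Finset.inter_eq_right.2 hn, Finset.prod_const]
  · refine MeasurableSet.univ_pi fun i => ?_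
    split_ifs
    exacts [hB, MeasurableSet.univ]

/-- The event that all letters of the `j`-th block of length `k` lie in `B`. -/
def blockEvent (B : Set Ω) (k j : ℕ) : Set (ℕ → Ω) := {ωb | ∀ i < k, ωb (j * k + i) ∈ B}

lemma measurableSet_blockEvent {B : Set Ω} (hB : MeasurableSet B) (k j : ℕ) :
    MeasurableSet (blockEvent B k j) := by
  have : blockEvent B k j = ⋂ i ∈ Finset.range k, (fun ωb => ωb (j * k + i)) ⁻¹' B := by
    ext; simp [blockEvent]
  rw [this]
  exact Finset.measurableSet_biInter _ fun i _ => measurable_pi_apply _ hB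

lemma measure_biInter_blockEvent
    (hPb : ∀ n : ℕ, Pb.map (fun ωb (i : Fin n) => ωb i) = Measure.pi fun _ : Fin n => p)
    {B : Set Ω} (hB : MeasurableSet B) (k : ℕ) (S : Finset ℕ) :
    Pb (⋂ j ∈ S, blockEvent B k j) = (p B ^ k) ^ S.card := by
  classical
  have hset : (⋂ j ∈ S, blockEvent B k j) =
      {ωb | ∀ i ∈ S.biUnion fun j => (Finset.range k).image fun i => j * k + i, ωb i ∈ B} := by
    ext ωb
    simp only [blockEvent, Set.mem_iInter, Set.mem_ofPred_eq, Finset.mem_biUnion, Finset.mem_image,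
      Finset.mem_range]
    exact ⟨fun h _ ⟨j, hj, i, hi, e⟩ => e ▸ h j hj i hi,
      fun h j hj i hi => h _ ⟨j, hj, i, hi, rfl⟩⟩
  rw [hset, measure_forall_mem_finset hPb hB, ← pow_mul, Finset.card_biUnion]
  · simp_rw [Finset.card_image_of_injective _ (add_right_injective _), Finset.card_range]
    simp [mul_comm]
  · intro j _ j' _ hne
    rw [Function.onFun, Finset.disjoint_left]
    intro a ha ha'
    simp only [Finset.mem_image, Finset.mem_range] at ha ha'
    obtain ⟨i, hi, rfl⟩ := ha
    obtain ⟨i', hi', e⟩ := ha'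
    apply hne
    have h1 : (j * k + i) / k = j := by
      rw [mul_comm, Nat.mul_add_div (by omega), Nat.div_eq_of_lt hi, add_zero]
    have h2 : (j' * k + i') / k = j' := by
      rw [mul_comm, Nat.mul_add_div (by omega), Nat.div_eq_of_lt hi', add_zero]
    rw [← h1, ← h2, e]

open Classical in
lemma lintegral_prod_blockEvent [IsProbabilityMeasure Pb]
    (hPb : ∀ n : ℕ, Pb.map (fun ωb (i : Fin n) => ωb i) = Measure.pi fun _ : Fin n => p)
    {B : Set Ω} (hB : MeasurableSet B) (k m : ℕ) :
    ∫⁻ ωb, ENNReal.ofReal (∏ j ∈ Finset.range m,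
      if ωb ∈ blockEvent B k j then (1 / 2 : ℝ) else 1) ∂Pb =
      ENNReal.ofReal (1 - (p B).toReal ^ k / 2) ^ m := by
  have hind : iIndepSet (blockEvent B k) Pb := by
    rw [iIndepSet_iff_meas_biInter (measurableSet_blockEvent hB k)]
    intro S
    have h1 : ∀ j, Pb (blockEvent B k j) = p B ^ k := fun j => by
      simpa using measure_biInter_blockEvent hPb hB k {j}
    simp [measure_biInter_blockEvent hPb hB k S, h1]
  have hfun := (hind.iIndepFun_indicator (β := ℝ)).comp
    (fun _ t => ENNReal.ofReal (1 - t / 2)) (fun _ => by fun_prop)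
  have hpt : ∀ j ωb, ENNReal.ofReal (if ωb ∈ blockEvent B k j then (1 / 2 : ℝ) else 1) =
      ((fun t : ℝ => ENNReal.ofReal (1 - t / 2)) ∘
        (blockEvent B k j).indicator fun _ => (1 : ℝ)) ωb := fun j ωb => by
    by_cases h : ωb ∈ blockEvent B k j
    · norm_num [h]
    · simp [h]
  have hmeas : ∀ j, Measurable ((fun t : ℝ => ENNReal.ofReal (1 - t / 2)) ∘
      (blockEvent B k j).indicator fun _ => (1 : ℝ)) := fun j =>
    (by fun_prop : Measurable fun t : ℝ => ENNReal.ofReal (1 - t / 2)).comp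
      (measurable_const.indicator (measurableSet_blockEvent hB k j))
  have hprod : ∀ ωb, ENNReal.ofReal (∏ j ∈ Finset.range m,
      if ωb ∈ blockEvent B k j then (1 / 2 : ℝ) else 1) =
      ∏ j ∈ Finset.range m, ((fun t : ℝ => ENNReal.ofReal (1 - t / 2)) ∘
        (blockEvent B k j).indicator fun _ => (1 : ℝ)) ωb := fun ωb => by
    rw [ENNReal.ofReal_prod_of_nonneg fun j _ => by split_ifs <;> norm_num]
    exact Finset.prod_congr rfl fun j _ => hpt j ωb
  rw [lintegral_congr hprod, lintegral_prod_eq_prod_lintegral_of_indepFun _ _ hfun hmeas]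
  rw [Finset.prod_congr rfl fun j _ => ?_, Finset.prod_const, Finset.card_range]
  have hE := measurableSet_blockEvent hB k j
  have hi : Integrable ((blockEvent B k j).indicator fun _ => (1 : ℝ)) Pb :=
    (integrable_const 1).indicator hE
  have hle : ∀ ωb, (blockEvent B k j).indicator (fun _ => (1 : ℝ)) ωb ≤ 1 := fun ωb =>
    Set.indicator_le_self' (fun _ _ => zero_le_one) ωb
  simp only [Function.comp_apply]
  rw [← ofReal_integral_eq_lintegral_ofReal
    (f := fun ωb => 1 - (blockEvent B k j).indicator (fun _ => (1 : ℝ)) ωb / 2)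
    ((integrable_const 1).sub (hi.div_const 2))
    (Eventually.of_forall fun ωb => by
      have := hle ωb
      simp only [Pi.zero_apply]
      linarith)]
  have h1 : Pb (blockEvent B k j) = p B ^ k := by
    simpa using measure_biInter_blockEvent hPb hB k {j}
  rw [integral_sub (integrable_const 1) (hi.div_const 2), integral_div,
    integral_indicator_const _ hE, measureReal_def, h1]
  simp

open Classical in
/-- Almost sure exponential decay of `2 ^ (-#{good blocks})`. -/
lemma exists_random_time_blockEvent [IsProbabilityMeasure Pb]
    (hPb : ∀ n : ℕ, Pb.map (fun ωb (i : Fin n) => ωb i) = Measure.pi fun _ : Fin n => p)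
    {B : Set Ω} (hB : MeasurableSet B) (hpB : 0 < p B) {k : ℕ} (hk : 0 < k) :
    ∃ α : ℝ, 0 < α ∧ ∃ (S : Set (ℕ → Ω)) (n₀ : (ℕ → Ω) → ℕ), Pb S = 1 ∧ Measurable n₀ ∧
      Integrable (fun ωb => Real.exp (α * n₀ ωb)) Pb ∧
      ∀ ωb ∈ S, ∀ n : ℕ, n₀ ωb ≤ n →
        (∏ j ∈ Finset.range (n / k), if ωb ∈ blockEvent B k j then (1 / 2 : ℝ) else 1) ≤
          Real.exp (-α * n) := by
  set ρ : ℝ := 1 - (p B).toReal ^ k / 2 with hρ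
  have hδ : 0 < (p B).toReal ^ k := pow_pos (ENNReal.toReal_pos hpB.ne' (measure_ne_top _ _)) _
  have hδ1 : (p B).toReal ^ k ≤ 1 := pow_le_one₀ ENNReal.toReal_nonneg
    (ENNReal.toReal_le_of_le_ofReal zero_le_one (by simpa using prob_le_one))
  have hρ0 : 0 < ρ := by linarith
  have hρ1 : ρ < 1 := by linarith
  have hk' : (0 : ℝ) < k := by exact_mod_cast hk
  set β : ℝ := -Real.log ρ / (2 * k) with hβ
  have hβ0 : 0 < β := div_pos (neg_pos.2 (Real.log_neg hρ0 hρ1)) (by positivity)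
  have hρβ : ρ = Real.exp (-(2 * β * k)) := by
    rw [hβ, show -(2 * (-Real.log ρ / (2 * k)) * k) = Real.log ρ by field_simp, Real.exp_log hρ0]
  obtain ⟨S, n₀, h⟩ := exists_random_time_exp_decay Pb
    (r := fun n ωb => ∏ j ∈ Finset.range (n / k),
      if ωb ∈ blockEvent B k j then (1 / 2 : ℝ) else 1)
    (fun n => Finset.measurable_prod _ fun j _ =>
      Measurable.ite (measurableSet_blockEvent hB k j) measurable_const measurable_const)
    (K := Real.exp (2 * β * k)) hβ0 (fun n => by
      rw [lintegral_prod_blockEvent hPb hB, ← hρ, ← ENNReal.ofReal_pow hρ0.le]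
      refine ENNReal.ofReal_le_ofReal ?_
      rw [hρβ, ← Real.exp_nat_mul, ← Real.exp_add, Real.exp_le_exp]
      have h1 : (n : ℝ) ≤ (n / k : ℕ) * k + k := by
        exact_mod_cast (Nat.lt_div_mul_add hk (a := n)).le
      nlinarith)
  exact ⟨β / 2, by positivity, S, n₀, h⟩

end Probability

/-- Decaying process: if an RRDO `M` satisfies `p(M(ω) ∈ ℳ_(E)) > 0`, then
almost surely the products `M_Q(ω_1) ⋯ M_Q(ω_n)` decay exponentially for `n ≥ n₀(ω̄)`, with
`E[e^{α n₀}] < ∞`.  Here `Pb` is the infinite product measure on `Ω^{ℕ*} = ℕ → Ω`,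
characterized by its finite-dimensional marginals. -/
theorem stmt7 {d : ℕ} (hd : 1 ≤ d) {Ω : Type*} [MeasurableSpace Ω]
    (p : Measure Ω) [IsProbabilityMeasure p]
    (M : Ω → Op d) (hMmeas : Measurable M)
    (Nrm : Seminorm ℂ (Evec d)) (hNrm : ∀ x, Nrm x = 0 → x = 0)
    (hcontr : ∀ (ω : Ω) (x : Evec d), Nrm (M ω x) ≤ Nrm x)
    (ψS : Evec d) (hψS : ‖ψS‖ = 1) (hfix : ∀ ω, M ω ψS = ψS)
    (Pb : Measure (ℕ → Ω)) [IsProbabilityMeasure Pb]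
    (hPb : ∀ n : ℕ, Pb.map (fun ωb (i : Fin n) => ωb i) = Measure.pi fun _ : Fin n => p)
    (hpos : 0 < p {ω | mcalE ψS (M ω)}) :
    ∃ C α : ℝ, 0 < C ∧ 0 < α ∧
      ∃ (Ω₁ : Set (ℕ → Ω)) (n₀ : (ℕ → Ω) → ℕ),
        Pb Ω₁ = 1 ∧ Measurable n₀ ∧
        Integrable (fun ωb => Real.exp (α * n₀ ωb)) Pb ∧
        ∀ ωb ∈ Ω₁, ∀ n : ℕ, n₀ ωb ≤ n →
          ‖(List.ofFn fun i : Fin n => MQof ψS (M (ωb i))).prod‖ ≤ C * Real.exp (-α * n) := by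
  classical
  obtain ⟨a, ha, hNa⟩ := Nrm.exists_norm_le_mul hNrm
  obtain ⟨b, hb, hNb⟩ := Nrm.exists_le_mul_norm
  have hD : ∀ ω n, ‖M ω ^ n‖ ≤ a * b := fun ω =>
    norm_pow_le_of_seminorm_contraction ha hb hNa hNb (hcontr ω)
  -- a matrix of `ℳ_(E)` all of whose neighbourhoods are charged by the law of `M`
  obtain ⟨A₀, hA₀, hsupp⟩ := exists_mem_forall_mem_nhdsWithin_pos_measure (μ := p.map M)
    (s := {A | mcalE ψS A})
    (hpos.trans_le (Measure.le_map_apply hMmeas.aemeasurable {A | mcalE ψS A})).ne'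
  obtain ⟨k, hk, hkA⟩ := exists_norm_orthProj_mul_pow_lt hψS hA₀
    (show (0 : ℝ) < 1 / (2 * a * b) by positivity)
  have hV : {X : Op d | ‖orthProj ψS * X‖ < 1 / (2 * a * b)} ∈ 𝓝 (A₀ ^ k) :=
    (isOpen_lt (by fun_prop) continuous_const).mem_nhds hkA
  obtain ⟨U, hUo, hAU, hU⟩ := exists_open_prefixProd_mem A₀ k hV
  have hB : MeasurableSet (M ⁻¹' U) := hMmeas hUo.measurableSet
  have hpB : 0 < p (M ⁻¹' U) := by
    rw [← Measure.map_apply hMmeas hUo.measurableSet]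
    exact hsupp U (mem_nhdsWithin_of_mem_nhds (hUo.mem_nhds hAU))
  obtain ⟨α, hα, S, n₀, hS, hn₀, hint, hdecay⟩ := exists_random_time_blockEvent hPb hB hpB hk
  refine ⟨1 + (1 + a * b) * a * b, α, by positivity, hα, S, n₀, hS, hn₀, hint,
    fun ωb hωb n hn => ?_⟩
  change ‖prefixProd (fun i => MQof ψS (M (ωb i))) n‖ ≤ _
  rcases n with _ | n
  · have h1 : ‖(1 : Op d)‖ ≤ 1 := ContinuousLinearMap.norm_id_le
    have h2 : 0 ≤ (1 + a * b) * a * b := by positivity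
    simpa [prefixProd_zero] using h1.trans (by linarith)
  have hr : (∏ j ∈ Finset.range ((n + 1) / k),
      if ∀ i < k, M (ωb (j * k + i)) ∈ U then (1 / 2 : ℝ) else 1) ≤
        Real.exp (-α * (n + 1 : ℕ)) := by
    convert hdecay ωb hωb (n + 1) hn
    rfl
  rw [prefixProd_MQof hψS (fun i => hD (ωb i)) (fun i => hfix (ωb i))]
  refine ContinuousLinearMap.opNorm_le_bound _ (by positivity) fun x => ?_
  have hq := quotNorm_prefixProd_le (N := Nrm) (ψS := ψS) (f := fun i => M (ωb i)) (k := k) (U := U)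
    (fun i => hcontr _) (fun i => hfix _)
    (fun g hg hgU => quotNorm_apply_le_half hψS ha hb hNa hNb (prefixProd_apply_fixed hg k)
      (hU g hgU).le) (n + 1) x
  have hq' := hq.trans (mul_le_mul_of_nonneg_right (by convert hr) (quotNorm_nonneg x))
  have hx : quotNorm Nrm ψS x ≤ b * ‖x‖ := (quotNorm_le_self x).trans (hNb x)
  rw [mul_apply_eq_comp]
  calc ‖Qof ψS (M (ωb 0)) (prefixProd (fun i => M (ωb i)) (n + 1) x)‖
      ≤ ‖Qof ψS (M (ωb 0))‖ * a * quotNorm Nrm ψS (prefixProd (fun i => M (ωb i)) (n + 1) x) :=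
        norm_apply_le_quotNorm ha.le hNa (Qof_apply_fixed hψS (hD _) (hfix _)) _
    _ ≤ (1 + a * b) * a * (Real.exp (-α * (n + 1 : ℕ)) * (b * ‖x‖)) := by
        gcongr
        · exact quotNorm_nonneg _
        · exact norm_Qof_le hψS (hD _)
        · exact hq'.trans (by gcongr)
    _ ≤ (1 + (1 + a * b) * a * b) * Real.exp (-α * (n + 1 : ℕ)) * ‖x‖ := by
        have : 0 ≤ Real.exp (-α * (n + 1 : ℕ)) * ‖x‖ := by positivity
        linarith
end
end

section
/- Let (Ω, F, p) be a probability space and M : Ω → M_d(ℂ) a random reduced dynamics operator with fixed invariant unit vector ψ_S and contraction norm |||·|||. Suppose p({ω : M(ω) ∈ ℳ_(E)}) > 0. Then the expectation matrix E[M] (entrywise integral of M over Ω) satisfies: E[M] ψ_S = ψ_S; E[M] is a contraction for |||·|||; σ(E[M]) ∩ {z ∈ ℂ : |z| = 1} = {1}; and 1 is an eigenvalue of E[M] of algebraic multiplicity one. In other words, E[M] ∈ ℳ_(E). -/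
open scoped BigOperators
open MeasureTheory Filter ContinuousLinearMap

noncomputable section

theorem Seminorm.exists_norming_functional {V : Type*} [AddCommGroup V] [Module ℂ V]
    (N : Seminorm ℂ V) (v : V) :
    ∃ f : V →ₗ[ℂ] ℂ, (∀ x, ‖f x‖ ≤ N x) ∧ f v = N v := by
  let : SeminormedAddCommGroup V := N.toAddGroupSeminorm.toSeminormedAddCommGroup
  let : NormedSpace ℂ V := ⟨fun a b => (map_smul_eq_mul N a b).le⟩
  obtain ⟨g, hg, hgv⟩ := exists_dual_vector'' ℂ v
  exact ⟨g, fun x => g.le_of_opNorm_le hg x |>.trans_eq (one_mul _), hgv⟩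

theorem Seminorm.exists_bounds_of_definite {V : Type*} [NormedAddCommGroup V] [NormedSpace ℂ V]
    [FiniteDimensional ℂ V] (N : Seminorm ℂ V) (hN : ∀ x, N x = 0 → x = 0) :
    ∃ C : ℝ, 0 ≤ C ∧ (∀ x, ‖x‖ ≤ C * N x) ∧ ∀ x, N x ≤ C * ‖x‖ := by
  have key : ∀ (W : Type _) [AddCommGroup W] [Module ℂ W] [FiniteDimensional ℂ W]
      (N' : Seminorm ℂ W) (_ : ∀ x, N' x = 0 → x = 0) (e : W ≃ₗ[ℂ] V),
      ∃ C : ℝ, 0 ≤ C ∧ (∀ x, ‖e x‖ ≤ C * N' x) ∧ ∀ x, N' x ≤ C * ‖e x‖ := by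
    intro W _ _ _ N' hN' e
    let : NormedAddCommGroup W := AddGroupNorm.toNormedAddCommGroup
      { N'.toAddGroupSeminorm with eq_zero_of_map_eq_zero' := hN' }
    let : NormedSpace ℂ W := ⟨fun a b => (map_smul_eq_mul N' a b).le⟩
    let e' := e.toContinuousLinearEquiv
    refine ⟨max ‖(e' : W →L[ℂ] V)‖ ‖(e'.symm : V →L[ℂ] W)‖, by positivity, fun x => ?_,
      fun x => ?_⟩
    · exact (e' : W →L[ℂ] V).le_of_opNorm_le (le_max_left _ _) x
    · have h := (e'.symm : V →L[ℂ] W).le_of_opNorm_le (le_max_right ‖(e' : W →L[ℂ] V)‖ _) (e x)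
      have hx : (e'.symm : V →L[ℂ] W) (e x) = x := e.symm_apply_apply x
      rw [hx] at h
      exact h
  exact key V N hN (LinearEquiv.refl ℂ V)

theorem eq_apply_integral_of_mem_support {X Ω : Type*} [NormedAddCommGroup X] [NormedSpace ℂ X]
    [CompleteSpace X] [MeasurableSpace X] [BorelSpace X] [MeasurableSpace Ω] {p : Measure Ω}
    [IsProbabilityMeasure p] {M : Ω → X} (hM : Measurable M) (hint : Integrable M p)
    (L : X →L[ℂ] ℂ) (hL : ∀ ω, ‖L (M ω)‖ ≤ ‖L (∫ ω, M ω ∂p)‖) {A : X}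
    (hA : A ∈ (p.map M).support) : L A = L (∫ ω, M ω ∂p) := by
  have hcomm : ∫ ω, L (M ω) ∂p = L (∫ ω, M ω ∂p) := L.integral_comp_comm hint
  have hae : ∀ᵐ ω ∂p, L (M ω) = L (∫ ω, M ω ∂p) := by
    rcases ae_eq_const_or_norm_integral_lt_of_norm_le_const (ae_of_all p hL) with h | h
    · filter_upwards [h] with ω hω
      rw [hω, Function.const_apply, average_eq_integral, hcomm]
    · simp [hcomm] at h
  have hclosed : IsClosed {B : X | L B = L (∫ ω, M ω ∂p)} :=
    isClosed_eq L.continuous continuous_const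
  exact Measure.support_subset_of_isClosed hclosed
    ((ae_map_iff hM.aemeasurable hclosed.measurableSet).2 hae) hA

section Contraction

variable {V : Type*} [NormedAddCommGroup V] [NormedSpace ℂ V]

theorem Seminorm.apply_pow_le {N : Seminorm ℂ V} {A : V →L[ℂ] V} (hA : ∀ x, N (A x) ≤ N x)
    (n : ℕ) (x : V) : N ((A ^ n) x) ≤ N x := by
  induction n with
  | zero => simp
  | succ n ih => rw [pow_succ', mul_apply_eq_comp]; exact (hA _).trans ih

theorem ContinuousLinearMap.pow_apply_eq_smul {E : V →L[ℂ] V} {v : V} {z : ℂ} (h : E v = z • v)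
    (n : ℕ) : (E ^ n) v = z ^ n • v := by
  induction n with
  | zero => simp
  | succ n ih => rw [pow_succ, mul_apply_eq_comp, h, map_smul, ih, smul_smul, pow_succ']

theorem Seminorm.maxGenEigenspace_one_eq_of_contraction {N : Seminorm ℂ V}
    (hN : ∀ x, N x = 0 → x = 0) {E : V →L[ℂ] V} (hE : ∀ x, N (E x) ≤ N x) :
    Module.End.maxGenEigenspace (E : V →ₗ[ℂ] V) 1 =
      Module.End.eigenspace (E : V →ₗ[ℂ] V) 1 := by
  have fixed_of_sub : ∀ x, E (E x - x) = E x - x → E x = x := by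
    intro x hx
    have hpow : ∀ n : ℕ, (E ^ n) x = x + n • (E x - x) := by
      intro n
      induction n with
      | zero => simp
      | succ n ih =>
        rw [pow_succ', mul_apply_eq_comp, ih, map_add, map_nsmul, hx, succ_nsmul]
        abel
    refine sub_eq_zero.1 (hN _ ?_)
    by_contra hne
    have hpos : 0 < N (E x - x) := lt_of_le_of_ne (apply_nonneg N _) (Ne.symm hne)
    obtain ⟨n, hn⟩ := exists_nat_gt (2 * N x / N (E x - x))
    rw [div_lt_iff₀ hpos] at hn
    have h1 : N (n • (E x - x)) = n * N (E x - x) := by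
      rw [← Nat.cast_smul_eq_nsmul ℂ, map_smul_eq_mul]; simp
    have h2 : N (n • (E x - x)) ≤ N x + N x := by
      have : n • (E x - x) = (E ^ n) x - x := by rw [hpow n]; abel
      rw [this]
      exact (map_sub_le_add N _ _).trans (by gcongr; exact apply_pow_le hE n x)
    linarith
  refine le_antisymm (fun x hx => ?_) Module.End.eigenspace_le_maxGenEigenspace
  obtain ⟨k, hk⟩ := (Module.End.mem_maxGenEigenspace _ _ _).1 hx
  clear hx
  rw [one_smul] at hk
  rw [Module.End.mem_eigenspace_iff, one_smul]
  induction k generalizing x with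
  | zero => simp_all
  | succ k ih =>
    rw [pow_succ, Module.End.mul_apply] at hk
    exact fixed_of_sub x (ih _ hk)

variable {Ω : Type*} [FiniteDimensional ℂ V] [MeasurableSpace Ω] {p : Measure Ω}
  [IsProbabilityMeasure p] {M : Ω → V →L[ℂ] V} {N : Seminorm ℂ V}

theorem integral_contraction (hint : Integrable M p)
    (hcontr : ∀ ω x, N (M ω x) ≤ N x) (x : V) : N ((∫ ω, M ω ∂p) x) ≤ N x := by
  obtain ⟨f, hf, hfx⟩ := N.exists_norming_functional ((∫ ω, M ω ∂p) x)
  have h : f ((∫ ω, M ω ∂p) x) = ∫ ω, f (M ω x) ∂p :=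
    ((f.toContinuousLinearMap ∘L ContinuousLinearMap.apply ℂ V x).integral_comp_comm hint).symm
  have h' : ‖∫ ω, f (M ω x) ∂p‖ ≤ N x := by
    simpa using norm_integral_le_of_norm_le_const (μ := p) (ae_of_all _ fun ω =>
      (hf (M ω x)).trans (hcontr ω x))
  rw [← h, hfx] at h'
  simpa [abs_of_nonneg (apply_nonneg N _)] using h'

variable [MeasurableSpace (V →L[ℂ] V)] [BorelSpace (V →L[ℂ] V)]

theorem integrable_of_contraction (hM : Measurable M) (hN : ∀ x, N x = 0 → x = 0)
    (hcontr : ∀ ω x, N (M ω x) ≤ N x) : Integrable M p := by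
  obtain ⟨C, hC, hle, hge⟩ := N.exists_bounds_of_definite hN
  refine Integrable.of_bound hM.aestronglyMeasurable (C * C) (ae_of_all _ fun ω => ?_)
  refine opNorm_le_bound _ (by positivity) fun x => ?_
  calc ‖M ω x‖ ≤ C * N (M ω x) := hle _
    _ ≤ C * (C * ‖x‖) := by gcongr; exact (hcontr ω x).trans (hge x)
    _ = C * C * ‖x‖ := by ring

theorem apply_pow_eq_of_mem_support (hM : Measurable M) (hint : Integrable M p)
    (hcontr : ∀ ω x, N (M ω x) ≤ N x) {A : V →L[ℂ] V}
    (hA : A ∈ (p.map M).support) (hAcontr : ∀ x, N (A x) ≤ N x) {v : V} {z : ℂ} (hz : ‖z‖ = 1)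
    (hv : (∫ ω, M ω ∂p) v = z • v) {f : V →ₗ[ℂ] ℂ} (hf : ∀ x, ‖f x‖ ≤ N x) (hfv : f v = N v)
    (n : ℕ) : f ((A ^ n) v) = z ^ n * f v := by
  set E := ∫ ω, M ω ∂p with hE
  have hEcontr := integral_contraction hint hcontr
  suffices h : ∀ k, f ((E ^ k) ((A ^ n) v)) = z ^ (k + n) * f v by simpa using h 0
  induction n with
  | zero => intro k; simp [pow_apply_eq_smul hv]
  | succ n ih =>
    intro k
    let L : (V →L[ℂ] V) →L[ℂ] ℂ :=
      (f.toContinuousLinearMap ∘L E ^ k) ∘L ContinuousLinearMap.apply ℂ V ((A ^ n) v)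
    have hLE : L E = z ^ (k + (n + 1)) * f v := by
      have := ih (k + 1)
      rw [pow_succ, mul_apply_eq_comp] at this
      rw [show k + (n + 1) = k + 1 + n by ring, ← this]
      rfl
    have hL : ∀ ω, ‖L (M ω)‖ ≤ ‖L E‖ := fun ω => by
      rw [hLE, norm_mul, norm_pow, hz, one_pow, one_mul, hfv, Complex.norm_real,
        Real.norm_of_nonneg (apply_nonneg N v)]
      exact (hf _).trans <| (Seminorm.apply_pow_le hEcontr k _).trans <|
        (hcontr ω _).trans (Seminorm.apply_pow_le hAcontr n v)
    rw [← hLE, pow_succ', mul_apply_eq_comp]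
    exact eq_apply_integral_of_mem_support hM hint L hL hA

open Polynomial in
theorem apply_aeval_eq_of_mem_support (hM : Measurable M) (hint : Integrable M p)
    (hcontr : ∀ ω x, N (M ω x) ≤ N x) {A : V →L[ℂ] V}
    (hA : A ∈ (p.map M).support) (hAcontr : ∀ x, N (A x) ≤ N x) {v : V} {z : ℂ} (hz : ‖z‖ = 1)
    (hv : (∫ ω, M ω ∂p) v = z • v) {f : V →ₗ[ℂ] ℂ} (hf : ∀ x, ‖f x‖ ≤ N x) (hfv : f v = N v)
    (q : ℂ[X]) : f (aeval (A : V →ₗ[ℂ] V) q v) = q.eval z * f v := by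
  induction q using Polynomial.induction_on' with
  | add a b ha hb => simp [ha, hb, add_mul]
  | monomial n a =>
    have h := apply_pow_eq_of_mem_support hM hint hcontr hA hAcontr hz hv hf hfv n
    rw [← coe_coe, ContinuousLinearMap.toLinearMap_pow] at h
    simp [aeval_monomial, h, mul_assoc]

theorem mem_spectrum_of_mem_support (hM : Measurable M) (hint : Integrable M p)
    (hN : ∀ x, N x = 0 → x = 0) (hcontr : ∀ ω x, N (M ω x) ≤ N x) {A : V →L[ℂ] V}
    (hA : A ∈ (p.map M).support) (hAcontr : ∀ x, N (A x) ≤ N x) {z : ℂ} (hz : ‖z‖ = 1)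
    (h : z ∈ spectrum ℂ (∫ ω, M ω ∂p)) : z ∈ spectrum ℂ A := by
  have : CompleteSpace V := FiniteDimensional.complete ℂ V
  rw [ContinuousLinearMap.spectrum_eq, ← Module.End.hasEigenvalue_iff_mem_spectrum] at h ⊢
  obtain ⟨v, hv⟩ := h.exists_hasEigenvector
  obtain ⟨f, hf, hfv⟩ := N.exists_norming_functional v
  have := apply_aeval_eq_of_mem_support hM hint hcontr hA hAcontr hz hv.apply_eq_smul hf hfv
    (minpoly ℂ (A : V →ₗ[ℂ] V))
  rw [minpoly.aeval, LinearMap.zero_apply, map_zero, eq_comm, mul_eq_zero, hfv] at this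
  exact Module.End.hasEigenvalue_of_isRoot
    (this.resolve_right fun h0 => hv.2 (hN v (by exact_mod_cast h0)))

open Polynomial in
theorem mem_span_of_integral_apply_eq (hM : Measurable M) (hint : Integrable M p)
    (hN : ∀ x, N x = 0 → x = 0) (hcontr : ∀ ω x, N (M ω x) ≤ N x) {A : V →L[ℂ] V}
    (hA : A ∈ (p.map M).support) (hAcontr : ∀ x, N (A x) ≤ N x) {ψ : V} (hAψ : A ψ = ψ)
    (hEψ : (∫ ω, M ω ∂p) ψ = ψ)
    (hdim : Module.End.maxGenEigenspace (A : V →ₗ[ℂ] V) 1 ≤ Submodule.span ℂ {ψ}) {v : V}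
    (hv : (∫ ω, M ω ∂p) v = v) : v ∈ Submodule.span ℂ {ψ} := by
  set a : V →ₗ[ℂ] V := (A : V →ₗ[ℂ] V)
  obtain ⟨r, hr, hndvd⟩ := (minpoly ℂ a).exists_eq_pow_rootMultiplicity_mul_and_not_dvd
    (minpoly.ne_zero (Algebra.IsIntegral.isIntegral a)) 1
  set m := (minpoly ℂ a).rootMultiplicity 1
  have hr1 : r.eval 1 ≠ 0 := fun h => hndvd (dvd_iff_isRoot.2 h)
  have hmem : aeval a r v ∈ Module.End.maxGenEigenspace a 1 := by
    refine (Module.End.mem_maxGenEigenspace _ _ _).2 ⟨m, ?_⟩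
    have := congrArg (fun q => aeval a q v) hr
    rw [minpoly.aeval] at this
    simpa using this.symm
  obtain ⟨c, hc⟩ := Submodule.mem_span_singleton.1 (hdim hmem)
  have hrψ : aeval a r ψ = r.eval 1 • ψ :=
    Module.End.aeval_apply_of_mem_apply_eq_smul (by simpa [a] using hAψ)
  set w := r.eval 1 • v - c • ψ with hw
  have hrw : aeval a r w = 0 := by
    rw [hw, map_sub, map_smul, map_smul, hrψ, ← hc, smul_smul, smul_smul, mul_comm, sub_self]
  obtain ⟨f, hf, hfw⟩ := N.exists_norming_functional w
  have := apply_aeval_eq_of_mem_support hM hint hcontr hA hAcontr (z := 1) (by simp)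
    (v := w) (by simp [hw, hv, hEψ]) hf hfw r
  rw [hrw, map_zero, eq_comm, mul_eq_zero, hfw] at this
  have hw0 : w = 0 := hN w (by exact_mod_cast this.resolve_left hr1)
  rw [← Submodule.smul_mem_iff _ hr1, show r.eval 1 • v = c • ψ from sub_eq_zero.1 hw0]
  exact Submodule.smul_mem _ _ (Submodule.mem_span_singleton_self ψ)

end Contraction

/-- for an RRDO with `p(M(ω) ∈ ℳ_(E)) > 0`, the expectation matrix
`E[M] = ∫ M(ω) dp(ω)` fixes `ψ_S`, is a contraction for the same norm, has
`σ(E[M]) ∩ {|z|=1} = {1}` with `1` a simple eigenvalue; i.e. `E[M] ∈ ℳ_(E)`. -/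
theorem stmt8 {d : ℕ} (hd : 1 ≤ d) {Ω : Type*} [MeasurableSpace Ω]
    (p : Measure Ω) [IsProbabilityMeasure p]
    (M : Ω → Op d) (hMmeas : Measurable M)
    (Nrm : Seminorm ℂ (Evec d)) (hNrm : ∀ x, Nrm x = 0 → x = 0)
    (hcontr : ∀ (ω : Ω) (x : Evec d), Nrm (M ω x) ≤ Nrm x)
    (ψS : Evec d) (hψS : ‖ψS‖ = 1) (hfix : ∀ ω, M ω ψS = ψS)
    (hpos : 0 < p {ω | mcalE ψS (M ω)}) :
    (∫ ω, M ω ∂p) ψS = ψS ∧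
    (∀ x : Evec d, Nrm ((∫ ω, M ω ∂p) x) ≤ Nrm x) ∧
    spectrum ℂ (∫ ω, M ω ∂p) ∩ {z : ℂ | ‖z‖ = 1} = {1} ∧
    Module.finrank ℂ
      (Module.End.maxGenEigenspace ((∫ ω, M ω ∂p : Op d) : Evec d →ₗ[ℂ] Evec d) 1) = 1 ∧
    mcalE ψS (∫ ω, M ω ∂p) := by
  have hint : Integrable M p := integrable_of_contraction hMmeas hNrm hcontr
  have hψ0 : ψS ≠ 0 := fun h => by simp [h] at hψS
  have hEfix : (∫ ω, M ω ∂p) ψS = ψS := by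
    rw [integral_apply hint]
    simp [hfix]
  have hEcontr := integral_contraction hint hcontr
  obtain ⟨ω, hω, hsupp⟩ : ∃ ω, mcalE ψS (M ω) ∧ M ω ∈ (p.map M).support := by
    have hae : ∀ᵐ ω ∂p, M ω ∈ (p.map M).support :=
      ae_of_ae_map hMmeas.aemeasurable Measure.support_mem_ae
    have hfreq : ∃ᵐ ω ∂p, mcalE ψS (M ω) := frequently_ae_iff.2 hpos.ne'
    exact (hfreq.and_eventually hae).exists
  obtain ⟨-, -, hspec, hfin⟩ := hω
  have hdim : Module.End.maxGenEigenspace (M ω : Evec d →ₗ[ℂ] Evec d) 1 ≤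
      Submodule.span ℂ {ψS} := by
    have hmem : ψS ∈ Module.End.maxGenEigenspace (M ω : Evec d →ₗ[ℂ] Evec d) 1 :=
      Module.End.eigenspace_le_maxGenEigenspace
        (Module.End.mem_eigenspace_iff.2 (by simp [hfix ω]))
    refine (Submodule.eq_of_le_of_finrank_eq
      ((Submodule.span_singleton_le_iff_mem _ _).2 hmem) ?_).ge
    rw [hfin, finrank_span_singleton hψ0]
  have hEspec : spectrum ℂ (∫ ω, M ω ∂p) ∩ {z : ℂ | ‖z‖ = 1} = {1} := by
    refine Set.Subset.antisymm (fun z hz => ?_) (Set.singleton_subset_iff.2 ⟨?_, by simp⟩)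
    · rw [← hspec]
      exact ⟨mem_spectrum_of_mem_support hMmeas hint hNrm hcontr hsupp (hcontr ω) hz.2 hz.1, hz.2⟩
    · rw [ContinuousLinearMap.spectrum_eq, ← Module.End.hasEigenvalue_iff_mem_spectrum]
      exact Module.End.hasEigenvalue_of_hasEigenvector
        ⟨Module.End.mem_eigenspace_iff.2 (by simpa using hEfix), hψ0⟩
  have hEgen : Module.End.maxGenEigenspace
      ((∫ ω, M ω ∂p : Op d) : Evec d →ₗ[ℂ] Evec d) 1 = Submodule.span ℂ {ψS} := by
    rw [Seminorm.maxGenEigenspace_one_eq_of_contraction hNrm hEcontr]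
    refine le_antisymm (fun v hv => ?_) ((Submodule.span_singleton_le_iff_mem _ _).2
      (Module.End.mem_eigenspace_iff.2 (by simpa using hEfix)))
    exact mem_span_of_integral_apply_eq hMmeas hint hNrm hcontr hsupp (hcontr ω) (hfix ω) hEfix
      hdim (by simpa using Module.End.mem_eigenspace_iff.1 hv)
  have hEfin : Module.finrank ℂ (Module.End.maxGenEigenspace
      ((∫ ω, M ω ∂p : Op d) : Evec d →ₗ[ℂ] Evec d) 1) = 1 := by
    rw [hEgen, finrank_span_singleton hψ0]
  exact ⟨hEfix, hEcontr, hEspec, hEfin, ⟨Nrm, hNrm, hEcontr⟩, hEfix, hEspec, hEfin⟩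
end
end

section
/- Let (Ω, F, p) be a probability space and M : Ω → M_d(ℂ) a random reduced dynamics operator with fixed invariant unit vector ψ_S, and suppose p({ω : M(ω) ∈ ℳ_(E)}) > 0. Let θ_n(ω̄) := M(ω_n)^* ⋯ M(ω_2)^* ψ(ω_1) for ω̄ ∈ Ω^{ℕ*}. Then for every n ≥ 1 the expectation over the product measure ℙ satisfies E[θ_n] = Σ_{k=0}^{n−1} (E[M_Q]^*)^k E[ψ], and lim_{n→∞} E[θ_n] = P_{1,E[M]}^* ψ_S, where P_{1,E[M]} denotes the spectral projection of E[M] for the eigenvalue 1. -/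
open scoped BigOperators
open MeasureTheory Filter ContinuousLinearMap

noncomputable section

/-- The Cesàro averages of a power-bounded element of a proper normed algebra converge. -/
theorem exists_tendsto_cesaro {𝔸 : Type*} [NormedRing 𝔸] [NormedAlgebra ℂ 𝔸] [ProperSpace 𝔸]
    {A : 𝔸} {C : ℝ} (hA : ∀ k : ℕ, ‖A ^ k‖ ≤ C) :
    ∃ P : 𝔸, Tendsto (fun N : ℕ => (N : ℂ)⁻¹ • ∑ k ∈ Finset.range N, A ^ k) atTop (nhds P) ∧
      A * P = P ∧ P * A = P ∧ ‖P‖ ≤ C := by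
  set S : ℕ → 𝔸 := fun N : ℕ => (N : ℂ)⁻¹ • ∑ k ∈ Finset.range N, A ^ k with hS
  have hC : 0 ≤ C := (norm_nonneg _).trans (hA 0)
  have hbd : ∀ N, ‖S N‖ ≤ C := by
    intro N
    rcases Nat.eq_zero_or_pos N with rfl | hN
    · simpa [hS] using hC
    · have h1 : ‖∑ k ∈ Finset.range N, A ^ k‖ ≤ N * C := by
        simpa using norm_sum_le_of_le (Finset.range N) (fun k _ => hA k)
      have hN' : (0 : ℝ) < N := by exact_mod_cast hN
      calc ‖S N‖ ≤ (N : ℝ)⁻¹ * ‖∑ k ∈ Finset.range N, A ^ k‖ := by simp [hS, norm_smul]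
        _ ≤ (N : ℝ)⁻¹ * (N * C) := by gcongr
        _ = C := by field_simp
  have hcomm : ∀ N, S N * A = A * S N := fun N => by
    simp only [hS, smul_mul_assoc, mul_smul_comm, Finset.sum_mul, Finset.mul_sum, ← pow_succ,
      ← pow_succ']
  have hdiff : Tendsto (fun N => A * S N - S N) atTop (nhds 0) := by
    have h1 : ∀ N, A * S N - S N = (N : ℂ)⁻¹ • (A ^ N - 1) := fun N => by
      have := mul_geom_sum A N
      rw [sub_mul, one_mul] at this
      simp only [hS, mul_smul_comm, ← smul_sub, this]
    refine squeeze_zero_norm (a := fun N : ℕ => (N : ℝ)⁻¹ * (C + ‖(1 : 𝔸)‖)) (fun N => ?_) ?_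
    · rw [h1, norm_smul, norm_inv, Complex.norm_natCast]
      gcongr
      exact (norm_sub_le _ _).trans (by gcongr; exact hA N)
    · simpa using (tendsto_inv_atTop_nhds_zero_nat (𝕜 := ℝ)).mul_const (C + ‖(1 : 𝔸)‖)
  have hcl : ∀ (U : Ultrafilter ℕ) (P : 𝔸), ↑U ≤ (atTop : Filter ℕ) → Tendsto S U (nhds P) →
      A * P = P ∧ P * A = P := by
    intro U P hU hP
    have h1 := tendsto_nhds_unique ((hP.const_mul A).sub hP) (hdiff.mono_left hU)
    have h2 := tendsto_nhds_unique (hP.mul_const A) (by simpa only [hcomm] using hP.const_mul A)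
    exact ⟨sub_eq_zero.1 h1, h2.trans (sub_eq_zero.1 h1)⟩
  have hleft : ∀ (P : 𝔸), A * P = P → ∀ᶠ N in atTop, S N * P = P := by
    intro P hP
    have hk : ∀ k : ℕ, A ^ k * P = P := fun k => by
      induction k with
      | zero => simp
      | succ k ih => rw [pow_succ, mul_assoc, hP, ih]
    filter_upwards [eventually_gt_atTop 0] with N hN
    have hN' : (N : ℂ) ≠ 0 := by exact_mod_cast hN.ne'
    simp only [hS, smul_mul_assoc, Finset.sum_mul, hk, Finset.sum_const, Finset.card_range]
    rw [← Nat.cast_smul_eq_nsmul ℂ, inv_smul_smul₀ hN']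
  have hright : ∀ (P : 𝔸), P * A = P → ∀ᶠ N in atTop, P * S N = P := by
    intro P hP
    have hk : ∀ k : ℕ, P * A ^ k = P := fun k => by
      induction k with
      | zero => simp
      | succ k ih => rw [pow_succ', ← mul_assoc, hP, ih]
    filter_upwards [eventually_gt_atTop 0] with N hN
    have hN' : (N : ℂ) ≠ 0 := by exact_mod_cast hN.ne'
    simp only [hS, mul_smul_comm, Finset.mul_sum, hk, Finset.sum_const, Finset.card_range]
    rw [← Nat.cast_smul_eq_nsmul ℂ, inv_smul_smul₀ hN']
  have hmem : ∀ᶠ N in atTop, S N ∈ Metric.closedBall (0 : 𝔸) C :=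
    Eventually.of_forall fun N => by simpa using hbd N
  obtain ⟨P, hPC, hP⟩ := (isCompact_closedBall (0 : 𝔸) C).exists_mapClusterPt
    (f := atTop) (u := S) (by simpa using hmem)
  obtain ⟨U, hU, hUP⟩ := mapClusterPt_iff_ultrafilter.1 hP
  obtain ⟨hAP, hPA⟩ := hcl U P hU hUP
  refine ⟨P, (isCompact_closedBall (0 : 𝔸) C).tendsto_nhds_of_unique_mapClusterPt hmem ?_,
    hAP, hPA, by simpa using hPC⟩
  intro P' _ hP'
  obtain ⟨V, hV, hVP⟩ := mapClusterPt_iff_ultrafilter.1 hP'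
  obtain ⟨hAP', hPA'⟩ := hcl V P' hV hVP
  have h1 : P' * P = P := tendsto_nhds_unique (hVP.mul_const P)
    (tendsto_const_nhds.congr' ((hleft P hAP).filter_mono hV |>.mono fun _ h => h.symm))
  have h2 : P' * P = P' := tendsto_nhds_unique (hUP.const_mul P')
    (tendsto_const_nhds.congr' ((hright P' hPA').filter_mono hU |>.mono fun _ h => h.symm))
  exact h2.symm.trans h1

theorem Seminorm.exists_bounds {d : ℕ} (Nrm : Seminorm ℂ (Evec d))
    (hNrm : ∀ x, Nrm x = 0 → x = 0) :
    ∃ a b : ℝ, 0 < a ∧ 0 < b ∧ (∀ x, Nrm x ≤ a * ‖x‖) ∧ ∀ x, ‖x‖ ≤ b * Nrm x := by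
  have hc : Continuous Nrm := by
    have := (ConvexOn.locallyLipschitz (f := Nrm) Nrm.convexOn).continuous
    exact this
  obtain ⟨a, ha, hab⟩ := Seminorm.bound_of_continuous_normedSpace Nrm hc
  by_cases hne : (Metric.sphere (0 : Evec d) 1).Nonempty
  · obtain ⟨x₀, hx₀, hmin⟩ := (isCompact_sphere (0 : Evec d) 1).exists_isMinOn hne hc.continuousOn
    have hpos : 0 < Nrm x₀ := by
      refine lt_of_le_of_ne (apply_nonneg _ _) fun h => ?_
      have := hNrm x₀ h.symm
      simp [this] at hx₀
    refine ⟨a, (Nrm x₀)⁻¹, ha, by positivity, hab, fun x => ?_⟩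
    rcases eq_or_ne x 0 with rfl | hx
    · simp
    · have hx' : 0 < ‖x‖ := norm_pos_iff.2 hx
      have h1 : Nrm x₀ ≤ Nrm (((‖x‖⁻¹ : ℝ) : ℂ) • x) := hmin (by
        simp [norm_smul, hx'.ne'])
      rw [map_smul_eq_mul, Complex.norm_real, norm_inv, norm_norm] at h1
      rw [inv_mul_eq_div, le_div_iff₀ hpos, mul_comm]
      calc Nrm x₀ * ‖x‖ ≤ (‖x‖⁻¹ * Nrm x) * ‖x‖ := by gcongr
        _ = Nrm x := by field_simp
  · refine ⟨a, 1, ha, one_pos, hab, fun x => ?_⟩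
    have : x = 0 := by
      by_contra hx
      exact hne ⟨((‖x‖⁻¹ : ℝ) : ℂ) • x, by simp [norm_smul, hx]⟩
    simp [this]

theorem ContinuousLinearMap.exists_norm_pow_lt_of_forall_norm_eigenvalue_lt_one {d : ℕ}
    [Nontrivial (Evec d)] (B : Op d)
    (hB : ∀ (z : ℂ) (x : Evec d), x ≠ 0 → B x = z • x → ‖z‖ < 1) {ε : ℝ} (hε : 0 < ε) :
    ∃ k : ℕ, 0 < k ∧ ‖B ^ k‖ < ε := by
  have hsp : spectralRadius ℂ B < 1 := by
    obtain ⟨z, hz, hr⟩ := spectrum.exists_nnnorm_eq_spectralRadius B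
    rw [← hr]
    rw [ContinuousLinearMap.spectrum_eq, ← Module.End.hasEigenvalue_iff_mem_spectrum] at hz
    obtain ⟨x, hx⟩ := hz.exists_hasEigenvector
    have := hB z x hx.2 (by simpa using hx.apply_eq_smul)
    exact_mod_cast this
  obtain ⟨r, hr1, hr2⟩ := ENNReal.lt_iff_exists_nnreal_btwn.1 hsp
  have hr2' : r < 1 := by exact_mod_cast hr2
  have hev := (spectrum.pow_nnnorm_pow_one_div_tendsto_nhds_spectralRadius B).eventually
    (gt_mem_nhds hr1)
  have hpow : Tendsto (fun n : ℕ => (r : ℝ) ^ n) atTop (nhds 0) :=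
    tendsto_pow_atTop_nhds_zero_of_lt_one r.2 (by exact_mod_cast hr2')
  obtain ⟨k, ⟨hk1, hk2⟩, hk0⟩ := ((hev.and (hpow.eventually (gt_mem_nhds hε))).and
    (eventually_gt_atTop 0)).exists
  refine ⟨k, hk0, lt_of_le_of_lt ?_ hk2⟩
  have hk' : (k : ℝ) ≠ 0 := by positivity
  have := ENNReal.rpow_le_rpow hk1.le (z := (k : ℝ)) (by positivity)
  rw [← ENNReal.rpow_mul, one_div, inv_mul_cancel₀ hk', ENNReal.rpow_one,
    ENNReal.rpow_natCast] at this
  exact_mod_cast this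

/-- The operators that contract the seminorm `Nrm` and fix `ψS`. -/
def contractionsFixing {d : ℕ} (Nrm : Seminorm ℂ (Evec d)) (ψS : Evec d) : Submonoid (Op d) where
  carrier := {T | (∀ x, Nrm (T x) ≤ Nrm x) ∧ T ψS = ψS}
  one_mem' := by simp
  mul_mem' := fun {S T} hS hT =>
    ⟨fun x => (hS.1 (T x)).trans (hT.1 x), by rw [mul_apply_eq_comp, hT.2, hS.2]⟩

section Contractions

variable {d : ℕ} {Nrm : Seminorm ℂ (Evec d)} {ψS : Evec d}

theorem convex_contractionsFixing : Convex ℝ (contractionsFixing Nrm ψS : Set (Op d)) := by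
  intro S hS T hT s t hs ht hst
  refine ⟨fun x => ?_, ?_⟩
  · have h := Nrm.convexOn.2 (Set.mem_univ (S x)) (Set.mem_univ (T x)) hs ht hst
    calc Nrm ((s • S + t • T) x) ≤ s * Nrm (S x) + t * Nrm (T x) := by simpa using h
      _ ≤ s * Nrm x + t * Nrm x := by gcongr; exacts [hS.1 x, hT.1 x]
      _ = Nrm x := by rw [← add_mul, hst, one_mul]
  · change s • S ψS + t • T ψS = ψS
    rw [hS.2, hT.2, ← add_smul, hst, one_smul]

theorem isClosed_contractionsFixing :
    IsClosed (contractionsFixing Nrm ψS : Set (Op d)) := by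
  have hc : Continuous Nrm := (ConvexOn.locallyLipschitz (f := Nrm) Nrm.convexOn).continuous
  have : (contractionsFixing Nrm ψS : Set (Op d)) =
      (⋂ x, {T : Op d | Nrm (T x) ≤ Nrm x}) ∩ {T : Op d | T ψS = ψS} := by
    ext T; simp [contractionsFixing]
  rw [this]
  refine (isClosed_iInter fun x => isClosed_le (hc.comp (by fun_prop)) continuous_const).inter
    (isClosed_eq (by fun_prop) continuous_const)

theorem norm_le_of_mem_contractionsFixing {a b : ℝ} (hb0 : 0 ≤ b) (ha0 : 0 ≤ a)
    (ha : ∀ x, Nrm x ≤ a * ‖x‖) (hb : ∀ x, ‖x‖ ≤ b * Nrm x) {T : Op d}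
    (hT : T ∈ contractionsFixing Nrm ψS) : ‖T‖ ≤ b * a := by
  refine T.opNorm_le_bound (by positivity) fun x => ?_
  calc ‖T x‖ ≤ b * Nrm (T x) := hb _
    _ ≤ b * (a * ‖x‖) := by gcongr; exact (hT.1 x).trans (ha x)
    _ = b * a * ‖x‖ := by ring

/-- Basic properties of the Cesàro projection of a contraction fixing `ψS`. -/
theorem cesaroProj_spec {C : ℝ} (hC : ∀ T ∈ contractionsFixing Nrm ψS, ‖T‖ ≤ C) {T : Op d}
    (hT : T ∈ contractionsFixing Nrm ψS) :
    Tendsto (fun N : ℕ => (N : ℂ)⁻¹ • ∑ k ∈ Finset.range N, T ^ k) atTop (nhds (cesaroProj T)) ∧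
      T * cesaroProj T = cesaroProj T ∧ cesaroProj T * T = cesaroProj T ∧ ‖cesaroProj T‖ ≤ C := by
  have : ProperSpace (Op d) := FiniteDimensional.proper ℂ _
  obtain ⟨P, hP, h⟩ := exists_tendsto_cesaro (fun k => hC _ (pow_mem hT k))
  have : cesaroProj T = P := hP.limUnder_eq
  rw [this]
  exact ⟨hP, h⟩

theorem cesaroProj_apply_of_fixed_s11 {C : ℝ} (hC : ∀ T ∈ contractionsFixing Nrm ψS, ‖T‖ ≤ C)
    {T : Op d} (hT : T ∈ contractionsFixing Nrm ψS) {x : Evec d} (hx : T x = x) :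
    cesaroProj T x = x := by
  have h := ((ContinuousLinearMap.apply ℂ (Evec d) x).continuous.tendsto _).comp
    (cesaroProj_spec hC hT).1
  refine tendsto_nhds_unique h (tendsto_const_nhds.congr' ?_)
  filter_upwards [eventually_gt_atTop 0] with N hN
  have hk : ∀ k : ℕ, (T ^ k) x = x := fun k => by
    induction k with
    | zero => simp
    | succ k ih => rw [pow_succ, mul_apply_eq_comp, hx, ih]
  have hN' : (N : ℂ) ≠ 0 := by exact_mod_cast hN.ne'
  simp [hk, ← Nat.cast_smul_eq_nsmul ℂ, hN']

open scoped InnerProductSpace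

/-- `ψ = P₁^* ψ_S` is normalized against `ψ_S`. -/
theorem inner_psiOf_s11 {C : ℝ} (hC : ∀ T ∈ contractionsFixing Nrm ψS, ‖T‖ ≤ C) (hψS : ‖ψS‖ = 1)
    {T : Op d} (hT : T ∈ contractionsFixing Nrm ψS) : ⟪psiOf ψS T, ψS⟫_ℂ = 1 := by
  rw [psiOf, adjoint_inner_left, cesaroProj_apply_of_fixed_s11 hC hT hT.2,
    inner_self_eq_norm_sq_to_K, hψS]
  simp

theorem adjoint_psiOf {C : ℝ} (hC : ∀ T ∈ contractionsFixing Nrm ψS, ‖T‖ ≤ C)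
    {T : Op d} (hT : T ∈ contractionsFixing Nrm ψS) :
    adjoint T (psiOf ψS T) = psiOf ψS T := by
  refine ext_inner_right ℂ fun x => ?_
  rw [psiOf, adjoint_inner_left, adjoint_inner_left, adjoint_inner_left,
    ← mul_apply_eq_comp, (cesaroProj_spec hC hT).2.2.1]

theorem norm_psiOf_le {C : ℝ} (hC : ∀ T ∈ contractionsFixing Nrm ψS, ‖T‖ ≤ C) (hψS : ‖ψS‖ = 1)
    {T : Op d} (hT : T ∈ contractionsFixing Nrm ψS) : ‖psiOf ψS T‖ ≤ C := by
  refine (le_opNorm _ _).trans ?_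
  rw [hψS, mul_one, LinearIsometryEquiv.norm_map]
  exact (cesaroProj_spec hC hT).2.2.2

theorem MQof_eq_s11 {C : ℝ} (hC : ∀ T ∈ contractionsFixing Nrm ψS, ‖T‖ ≤ C) (hψS : ‖ψS‖ = 1)
    {T : Op d} (hT : T ∈ contractionsFixing Nrm ψS) :
    MQof ψS T = T - ketBra ψS (psiOf ψS T) := by
  have h1 : ∀ x, ⟪psiOf ψS T, T x⟫_ℂ = ⟪psiOf ψS T, x⟫_ℂ := fun x => by
    rw [← adjoint_inner_left, adjoint_psiOf hC hT]
  ext1 x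
  have h2 : ⟪psiOf ψS T, ψS⟫_ℂ = 1 := inner_psiOf_s11 hC hψS hT
  simp [MQof, Qof, ketBra, inner_sub_right, inner_smul_right, h1, h2, hT.2]

/-- If `1` is the only peripheral eigenvalue of `T` and is simple, then high powers of `T^*` are
small on the orthogonal complement of `ψ_S`. -/
theorem exists_norm_adjoint_pow_le {C : ℝ} (hC : ∀ T ∈ contractionsFixing Nrm ψS, ‖T‖ ≤ C)
    (hNrm : ∀ x, Nrm x = 0 → x = 0) (hψS : ‖ψS‖ = 1)
    {T : Op d} (hT : T ∈ contractionsFixing Nrm ψS) (hE : mcalE ψS T) {ε : ℝ} (hε : 0 < ε) :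
    ∃ k : ℕ, 0 < k ∧ ∀ y, ⟪y, ψS⟫_ℂ = 0 → ‖(adjoint T ^ k) y‖ ≤ ε * ‖y‖ := by
  have hψ0 : ψS ≠ 0 := by rintro rfl; simp at hψS
  have : Nontrivial (Evec d) := ⟨⟨ψS, 0, hψ0⟩⟩
  obtain ⟨-, hTP, hPT, -⟩ := cesaroProj_spec hC hT
  set P := cesaroProj T with hPdef
  have hfix : ∀ x, T x = x → ∃ c : ℂ, x = c • ψS := by
    intro x hx
    have hmem : ∀ z : Evec d, T z = z →
        z ∈ Module.End.maxGenEigenspace (T : Evec d →ₗ[ℂ] Evec d) 1 := fun z hz =>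
      Module.End.mem_maxGenEigenspace _ _ _ |>.2 ⟨1, by simp [hz]⟩
    obtain ⟨c, hc⟩ := exists_smul_eq_of_finrank_eq_one hE.2.2.2
      (x := ⟨ψS, hmem ψS hT.2⟩) (by simpa using hψ0) ⟨x, hmem x hx⟩
    exact ⟨c, by simpa using (congrArg Subtype.val hc).symm⟩
  set B : Op d := T * (1 - P) with hB
  have hPB : P * B = 0 := by
    rw [hB, ← mul_assoc, hPT, mul_sub, mul_one, sub_eq_zero]
    ext1 x
    exact (cesaroProj_apply_of_fixed_s11 hC hT (by rw [← mul_apply_eq_comp, hTP])).symm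
  have heig : ∀ (z : ℂ) (x : Evec d), x ≠ 0 → B x = z • x → ‖z‖ < 1 := by
    intro z x hx hBx
    by_contra! hz
    have hz0 : z ≠ 0 := by rintro rfl; simp at hz; linarith
    have hPx : P x = 0 := by
      have : z • P x = 0 := by
        rw [← map_smul, ← hBx, ← mul_apply_eq_comp, hPB, zero_apply]
      exact (smul_eq_zero.1 this).resolve_left hz0
    have hTx : T x = z • x := by rw [← hBx, hB]; simp [hPx]
    have hNx : 0 < Nrm x := lt_of_le_of_ne (apply_nonneg _ _) fun h => hx (hNrm x h.symm)
    have hz1 : ‖z‖ = 1 := by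
      refine le_antisymm ?_ hz
      have := hT.1 x
      rw [hTx, map_smul_eq_mul] at this
      exact le_of_mul_le_mul_right (by simpa using this) hNx
    have hzs : z ∈ spectrum ℂ T := by
      rw [ContinuousLinearMap.spectrum_eq]
      exact (Module.End.hasEigenvalue_of_hasEigenvector
        (Module.End.hasEigenvector_iff.2 ⟨Module.End.mem_eigenspace_iff.2 hTx, hx⟩)).mem_spectrum
    have hz1' : z = 1 := by
      have : z ∈ spectrum ℂ T ∩ {z : ℂ | ‖z‖ = 1} := ⟨hzs, hz1⟩
      rw [hE.2.2.1] at this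
      exact this
    rw [hz1', one_smul] at hTx
    exact hx ((cesaroProj_apply_of_fixed_s11 hC hT hTx).symm.trans hPx)
  obtain ⟨k, hk0, hk⟩ := exists_norm_pow_lt_of_forall_norm_eigenvalue_lt_one B heig hε
  have hPrange : ∀ x, ∃ c : ℂ, P x = c • ψS := fun x =>
    hfix _ (by rw [← mul_apply_eq_comp, hTP])
  have hpow : ∀ (k : ℕ) (x : Evec d), ∃ c : ℂ, (T ^ k) x = (B ^ k) x + c • ψS := by
    intro k
    induction k with
    | zero => exact fun x => ⟨0, by simp⟩
    | succ k ih =>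
      intro x
      obtain ⟨c, hc⟩ := ih x
      obtain ⟨c', hc'⟩ := hPrange ((B ^ k) x)
      refine ⟨c + c', ?_⟩
      have hBv : ∀ v, B v = T v - T (P v) := fun v => by simp [hB]
      rw [pow_succ', pow_succ', mul_apply_eq_comp, hc, mul_apply_eq_comp, hBv, hc', map_add,
        map_smul, map_smul, hT.2, add_smul]
      abel
  refine ⟨k, hk0, fun y hy => ?_⟩
  have h : (adjoint T ^ k) y = adjoint (B ^ k) y := by
    refine ext_inner_right ℂ fun x => ?_
    obtain ⟨c, hc⟩ := hpow k x
    rw [← star_eq_adjoint, ← star_pow, star_eq_adjoint, adjoint_inner_left, adjoint_inner_left,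
      hc, inner_add_right, inner_smul_right, hy]
    simp
  rw [h]
  refine (le_opNorm _ _).trans ?_
  rw [LinearIsometryEquiv.norm_map]
  gcongr

/-- `y ⊥ ψ_S` and the dual norm of `y` with respect to `Nrm` is at most `c`. -/
structure DualBound (Nrm : Seminorm ℂ (Evec d)) (ψS : Evec d) (c : ℝ) (y : Evec d) : Prop where
  orth : ⟪y, ψS⟫_ℂ = 0
  norm_inner_le : ∀ x, ‖⟪y, x⟫_ℂ‖ ≤ c * Nrm x

theorem DualBound.add {c c' : ℝ} {y y' : Evec d} (h : DualBound Nrm ψS c y)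
    (h' : DualBound Nrm ψS c' y') : DualBound Nrm ψS (c + c') (y + y') where
  orth := by rw [inner_add_left, h.orth, h'.orth, add_zero]
  norm_inner_le x := by
    rw [inner_add_left, add_mul]
    exact (norm_add_le _ _).trans (add_le_add (h.norm_inner_le x) (h'.norm_inner_le x))

theorem DualBound.smul {c t : ℝ} (ht : 0 ≤ t) {y : Evec d} (h : DualBound Nrm ψS c y) :
    DualBound Nrm ψS (t * c) (t • y) where
  orth := by rw [inner_smul_left_eq_smul, h.orth, smul_zero]
  norm_inner_le x := by
    rw [inner_smul_left_eq_smul, norm_smul, Real.norm_of_nonneg ht, mul_assoc]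
    exact mul_le_mul_of_nonneg_left (h.norm_inner_le x) ht

theorem DualBound.adjoint {c : ℝ} (hc : 0 ≤ c) {y : Evec d} (h : DualBound Nrm ψS c y) {T : Op d}
    (hT : T ∈ contractionsFixing Nrm ψS) :
    DualBound Nrm ψS c (ContinuousLinearMap.adjoint T y) where
  orth := by rw [adjoint_inner_left, hT.2, h.orth]
  norm_inner_le x := by
    rw [adjoint_inner_left]
    exact (h.norm_inner_le _).trans (mul_le_mul_of_nonneg_left (hT.1 x) hc)

theorem DualBound.adjoint_pow {c : ℝ} (hc : 0 ≤ c) {y : Evec d} (h : DualBound Nrm ψS c y)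
    {T : Op d} (hT : T ∈ contractionsFixing Nrm ψS) (k : ℕ) :
    DualBound Nrm ψS c ((ContinuousLinearMap.adjoint T ^ k) y) := by
  induction k with
  | zero => simpa using h
  | succ k ih =>
    rw [pow_succ', mul_apply_eq_comp]
    exact ih.adjoint hc hT

theorem DualBound.of_norm_le {b c : ℝ} (hb : ∀ x, ‖x‖ ≤ b * Nrm x) {y : Evec d}
    (hy : ⟪y, ψS⟫_ℂ = 0) (hc : b * ‖y‖ ≤ c) : DualBound Nrm ψS c y where
  orth := hy
  norm_inner_le x := by
    calc ‖⟪y, x⟫_ℂ‖ ≤ ‖y‖ * ‖x‖ := norm_inner_le_norm _ _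
      _ ≤ ‖y‖ * (b * Nrm x) := by gcongr; exact hb x
      _ = b * ‖y‖ * Nrm x := by ring
      _ ≤ c * Nrm x := by gcongr

theorem DualBound.norm_le {a c : ℝ} (ha0 : 0 ≤ a) (hc : 0 ≤ c) (ha : ∀ x, Nrm x ≤ a * ‖x‖)
    {y : Evec d} (h : DualBound Nrm ψS c y) : ‖y‖ ≤ a * c := by
  rcases eq_or_ne y 0 with rfl | hy
  · simpa using mul_nonneg ha0 hc
  · have hy' : 0 < ‖y‖ := norm_pos_iff.2 hy
    have h1 : ‖y‖ * ‖y‖ ≤ (a * c) * ‖y‖ := by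
      calc ‖y‖ * ‖y‖ = ‖⟪y, y⟫_ℂ‖ := by simp [sq]
        _ ≤ c * Nrm y := h.norm_inner_le y
        _ ≤ c * (a * ‖y‖) := by gcongr; exact ha y
        _ = (a * c) * ‖y‖ := by ring
    exact le_of_mul_le_mul_right h1 hy'

/-- A contraction which is a convex combination of two contractions differs from the
corresponding multiple of a power of the first one by a controlled amount. -/
theorem DualBound.adjoint_pow_sub {S T N : Op d} (hS : S ∈ contractionsFixing Nrm ψS)
    (hT : T ∈ contractionsFixing Nrm ψS) (hN : N ∈ contractionsFixing Nrm ψS) {δ : ℝ}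
    (hδ0 : 0 ≤ δ) (hδ1 : δ ≤ 1) (hNST : N = δ • S + (1 - δ) • T) {c : ℝ} (hc : 0 ≤ c)
    {y : Evec d} (h : DualBound Nrm ψS c y) (k : ℕ) :
    DualBound Nrm ψS ((1 - δ ^ k) * c)
      ((ContinuousLinearMap.adjoint N ^ k) y -
        δ ^ k • (ContinuousLinearMap.adjoint S ^ k) y) := by
  induction k with
  | zero => exact ⟨by simp, by simp⟩
  | succ k ih =>
    have hδk : δ ^ k ≤ 1 := pow_le_one₀ hδ0 hδ1
    have hadj : ∀ v, ContinuousLinearMap.adjoint N v =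
        δ • ContinuousLinearMap.adjoint S v + (1 - δ) • ContinuousLinearMap.adjoint T v := by
      intro v
      refine ext_inner_right ℂ fun x => ?_
      rw [adjoint_inner_left, hNST, inner_add_left, inner_smul_left_eq_smul,
        inner_smul_left_eq_smul, adjoint_inner_left, adjoint_inner_left]
      simp [inner_add_right, inner_smul_right_eq_smul]
    have h1 := ih.adjoint (mul_nonneg (by linarith) hc) hN
    have h2 := (((h.adjoint_pow hc hS k).adjoint hc hT).smul (sub_nonneg.2 hδ1)).smul
      (pow_nonneg hδ0 k)
    convert h1.add h2 using 1
    · ring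
    · rw [pow_succ' (ContinuousLinearMap.adjoint N), pow_succ' (ContinuousLinearMap.adjoint S),
        mul_apply_eq_comp, mul_apply_eq_comp, map_sub, ContinuousLinearMap.map_smul_of_tower,
        hadj ((ContinuousLinearMap.adjoint S ^ k) y)]
      simp only [smul_add, smul_smul, pow_succ]
      abel

theorem tendsto_adjoint_pow_zero {a b : ℝ} (ha0 : 0 < a) (hb0 : 0 < b)
    (ha : ∀ x, Nrm x ≤ a * ‖x‖) (hb : ∀ x, ‖x‖ ≤ b * Nrm x)
    {S T N : Op d} (hS : S ∈ contractionsFixing Nrm ψS)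
    (hT : T ∈ contractionsFixing Nrm ψS) (hN : N ∈ contractionsFixing Nrm ψS) {δ : ℝ}
    (hδ0 : 0 < δ) (hδ1 : δ ≤ 1) (hNST : N = δ • S + (1 - δ) • T) {k : ℕ}
    (hk : 0 < k) (hSk : ∀ y, ⟪y, ψS⟫_ℂ = 0 → ‖(adjoint S ^ k) y‖ ≤ (2 * (a * b))⁻¹ * ‖y‖)
    {y : Evec d} (hy : ⟪y, ψS⟫_ℂ = 0) :
    Tendsto (fun n : ℕ => (adjoint N ^ n) y) atTop (nhds 0) := by
  have hδk0 : 0 < δ ^ k := pow_pos hδ0 k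
  have hδk : δ ^ k ≤ 1 := pow_le_one₀ hδ0.le hδ1
  set ρ : ℝ := 1 - δ ^ k / 2 with hρ
  have hρ0 : 0 ≤ ρ := by linarith
  have hρ1 : ρ < 1 := by linarith
  have hstep : ∀ (c : ℝ) (v : Evec d), 0 ≤ c → DualBound Nrm ψS c v →
      DualBound Nrm ψS (ρ * c) ((adjoint N ^ k) v) := by
    intro c v hc hv
    have h1 := hv.adjoint_pow_sub hS hT hN hδ0.le hδ1 hNST hc k
    have h2 : DualBound Nrm ψS (c / 2) ((adjoint S ^ k) v) := by
      refine DualBound.of_norm_le hb (hv.adjoint_pow hc hS k).orth ?_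
      calc b * ‖(adjoint S ^ k) v‖ ≤ b * ((2 * (a * b))⁻¹ * (a * c)) := by
            gcongr
            exact (hSk v hv.orth).trans (by gcongr; exact hv.norm_le ha0.le hc ha)
        _ = c / 2 := by field_simp
    convert h1.add (h2.smul hδk0.le) using 1
    · rw [hρ]; ring
    · abel
  have hc₀ : 0 ≤ b * ‖y‖ := by positivity
  have hy₀ : DualBound Nrm ψS (b * ‖y‖) y := DualBound.of_norm_le hb hy le_rfl
  have hiter : ∀ n : ℕ, DualBound Nrm ψS (ρ ^ n * (b * ‖y‖)) ((adjoint N ^ (k * n)) y) := by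
    intro n
    induction n with
    | zero => simpa using hy₀
    | succ n ih =>
      have := hstep _ _ (by positivity) ih
      rwa [← mul_apply_eq_comp, ← pow_add, ← mul_assoc, ← pow_succ', add_comm k,
        ← Nat.mul_succ] at this
  have hall : ∀ n : ℕ, ‖(adjoint N ^ n) y‖ ≤ a * (ρ ^ (n / k) * (b * ‖y‖)) := by
    intro n
    have := (hiter (n / k)).adjoint_pow (by positivity) hN (n % k)
    rw [← mul_apply_eq_comp, ← pow_add, Nat.mod_add_div] at this
    exact this.norm_le ha0.le (by positivity) ha
  refine squeeze_zero_norm hall ?_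
  have : Tendsto (fun n : ℕ => ρ ^ (n / k)) atTop (nhds 0) :=
    (tendsto_pow_atTop_nhds_zero_of_lt_one hρ0 hρ1).comp (Nat.tendsto_div_const_atTop hk.ne')
  simpa using (this.mul_const (b * ‖y‖)).const_mul a

end Contractions

theorem adjoint_integral {d : ℕ} {Ω : Type*} [MeasurableSpace Ω] {p : Measure Ω} {A : Ω → Op d}
    (hA : Integrable A p) : ∫ ω, adjoint (A ω) ∂p = adjoint (∫ ω, A ω ∂p) :=
  integral_comp_commSL (by simp)
    (adjoint : Op d ≃ₗᵢ⋆[ℂ] Op d).toContinuousLinearEquiv.toContinuousLinearMap hA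

section Expectation

variable {d : ℕ} {Ω : Type*} [MeasurableSpace Ω] {p : Measure Ω} [IsProbabilityMeasure p]
  {Nrm : Seminorm ℂ (Evec d)} {ψS : Evec d} {M : Ω → Op d}

/-- The expectation of a random contraction splits off the average over a neighbourhood of any
point in the support of its law. -/
theorem exists_integral_eq_convexComb (hMmeas : Measurable M) (hMint : Integrable M p)
    (hM : ∀ ω, M ω ∈ contractionsFixing Nrm ψS) {M₀ : Op d}
    (hM₀ : ∀ t ∈ nhds M₀, 0 < p.map M t) {r : ℝ} (hr : 0 < r) :
    ∃ S ∈ contractionsFixing Nrm ψS, ∃ T ∈ contractionsFixing Nrm ψS, ∃ δ : ℝ, 0 < δ ∧ δ ≤ 1 ∧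
      ‖S - M₀‖ ≤ r ∧ ∫ ω, M ω ∂p = δ • S + (1 - δ) • T := by
  set A : Set Ω := M ⁻¹' Metric.closedBall M₀ r with hA
  have hAm : MeasurableSet A := hMmeas Metric.isClosed_closedBall.measurableSet
  have hApos : p A ≠ 0 := by
    have := hM₀ _ (Metric.closedBall_mem_nhds M₀ hr)
    rw [Measure.map_apply hMmeas Metric.isClosed_closedBall.measurableSet] at this
    exact this.ne'
  have hS : (⨍ ω in A, M ω ∂p) ∈
      (contractionsFixing Nrm ψS : Set (Op d)) ∩ Metric.closedBall M₀ r :=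
    (convex_contractionsFixing.inter (convex_closedBall M₀ r)).set_average_mem
      (isClosed_contractionsFixing.inter Metric.isClosed_closedBall) hApos (measure_ne_top p A)
      ((ae_restrict_iff' hAm).2 (Eventually.of_forall fun ω hω => ⟨hM ω, hω⟩)) hMint.integrableOn
  have hsplit : ∫ ω, M ω ∂p =
      p.real A • (⨍ ω in A, M ω ∂p) + (1 - p.real A) • (⨍ ω in Aᶜ, M ω ∂p) := by
    rw [← probReal_compl_eq_one_sub hAm, measure_smul_setAverage _ (measure_ne_top p _),
      measure_smul_setAverage _ (measure_ne_top p _), integral_add_compl hAm hMint]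
  have hδ0 : 0 < p.real A := ENNReal.toReal_pos hApos (measure_ne_top p A)
  have hSr : ‖(⨍ ω in A, M ω ∂p) - M₀‖ ≤ r := mem_closedBall_iff_norm.1 hS.2
  by_cases hAc : p Aᶜ = 0
  · refine ⟨_, hS.1, _, hS.1, p.real A, hδ0, measureReal_le_one, hSr, ?_⟩
    have h1 : 1 - p.real A = 0 := by
      rw [← probReal_compl_eq_one_sub hAm, measureReal_def, hAc, ENNReal.toReal_zero]
    rw [hsplit, h1, zero_smul ℝ (_ : Op d), zero_smul ℝ (_ : Op d)]
  · refine ⟨_, hS.1, ⨍ ω in Aᶜ, M ω ∂p, ?_, p.real A, hδ0, measureReal_le_one, hSr, hsplit⟩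
    exact convex_contractionsFixing.set_average_mem isClosed_contractionsFixing hAc
      (measure_ne_top p _) (Eventually.of_forall hM) hMint.integrableOn

/-- Powers of `E[M]^*` tend to zero on the orthogonal complement of `ψ_S`. -/
theorem tendsto_adjoint_integral_pow (hMmeas : Measurable M) (hMint : Integrable M p)
    (hM : ∀ ω, M ω ∈ contractionsFixing Nrm ψS) (hNrm : ∀ x, Nrm x = 0 → x = 0)
    (hψS : ‖ψS‖ = 1) (hpos : 0 < p {ω | mcalE ψS (M ω)}) {y : Evec d} (hy : inner ℂ y ψS = 0) :
    Tendsto (fun n : ℕ => (adjoint (∫ ω, M ω ∂p) ^ n) y) atTop (nhds 0) := by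
  have : ProperSpace (Op d) := FiniteDimensional.proper ℂ _
  obtain ⟨a, b, ha0, hb0, ha, hb⟩ := Nrm.exists_bounds hNrm
  have hC : ∀ T ∈ contractionsFixing Nrm ψS, ‖T‖ ≤ b * a := fun T =>
    norm_le_of_mem_contractionsFixing hb0.le ha0.le ha hb
  have hs : p.map M ({T | mcalE ψS T} ∩ contractionsFixing Nrm ψS) ≠ 0 := by
    refine (hpos.trans_le ((measure_mono fun ω hω => ?_).trans
      (Measure.le_map_apply hMmeas.aemeasurable _))).ne'
    exact ⟨hω, hM ω⟩
  obtain ⟨M₀, ⟨hE, hM₀⟩, hsupp⟩ := exists_mem_forall_mem_nhdsWithin_pos_measure hs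
  have hε : 0 < (2 * (a * b))⁻¹ / 2 := by positivity
  obtain ⟨k, hk, hk'⟩ := exists_norm_adjoint_pow_le hC hNrm hψS hM₀ hE hε
  obtain ⟨r, hr, hrk⟩ := Metric.continuousAt_iff.1
    ((continuous_pow k).continuousAt (x := M₀)) _ hε
  obtain ⟨S, hS, T, hT, δ, hδ0, hδ1, hSr, hNST⟩ := exists_integral_eq_convexComb hMmeas hMint hM
    (fun t ht => hsupp t (mem_nhdsWithin_of_mem_nhds ht)) (half_pos hr)
  have hN : ∫ ω, M ω ∂p ∈ contractionsFixing Nrm ψS :=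
    convex_contractionsFixing.integral_mem isClosed_contractionsFixing (Eventually.of_forall hM)
      hMint
  refine tendsto_adjoint_pow_zero ha0 hb0 ha hb hS hT hN hδ0 hδ1 hNST hk (fun v hv => ?_) hy
  have h1 : ‖S ^ k - M₀ ^ k‖ ≤ (2 * (a * b))⁻¹ / 2 := by
    rw [← dist_eq_norm]
    exact (hrk (by rw [dist_eq_norm]; linarith)).le
  have h2 : (adjoint S ^ k) v = adjoint (S ^ k - M₀ ^ k) v + (adjoint M₀ ^ k) v := by
    simp only [map_sub, ← star_eq_adjoint, star_pow, sub_apply, sub_add_cancel]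
  calc ‖(adjoint S ^ k) v‖ ≤ ‖adjoint (S ^ k - M₀ ^ k) v‖ + ‖(adjoint M₀ ^ k) v‖ :=
        h2 ▸ norm_add_le _ _
    _ ≤ (2 * (a * b))⁻¹ / 2 * ‖v‖ + (2 * (a * b))⁻¹ / 2 * ‖v‖ := by
        refine add_le_add ((le_opNorm _ _).trans ?_) (hk' v hv)
        rw [LinearIsometryEquiv.norm_map]
        gcongr
    _ = (2 * (a * b))⁻¹ * ‖v‖ := by ring

/-- `A(w_n) ⋯ A(w_1) f(w_0)`. -/
def prodApply (A : Ω → Op d) (f : Ω → Evec d) : ∀ n : ℕ, (Fin (n + 1) → Ω) → Evec d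
  | 0, w => f (w 0)
  | n + 1, w => A (w (Fin.last (n + 1))) (prodApply A f n fun i => w i.castSucc)

theorem integrable_prodApply_and_integral_eq {A : Ω → Op d} {f : Ω → Evec d}
    (hA : Integrable A p) (hf : Integrable f p) (n : ℕ) :
    Integrable (prodApply A f n) (Measure.pi fun _ => p) ∧
      ∫ w, prodApply A f n w ∂(Measure.pi fun _ => p) = ((∫ ω, A ω ∂p) ^ n) (∫ ω, f ω ∂p) := by
  induction n with
  | zero =>
    have hmp : MeasurePreserving (fun w : Fin 1 → Ω => w 0) (Measure.pi fun _ => p) p :=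
      measurePreserving_eval (fun _ => p) 0
    refine ⟨hmp.integrable_comp_of_integrable hf, ?_⟩
    rw [pow_zero, one_apply_eq_self]
    conv_rhs => rw [← hmp.map_eq]
    rw [integral_map hmp.measurable.aemeasurable (by rw [hmp.map_eq]; exact hf.1)]
    rfl
  | succ n ih =>
    have hmp := measurePreserving_piFinSuccAbove (fun _ : Fin (n + 2) => p) (Fin.last (n + 1))
    have hcomp : prodApply A f (n + 1) = (fun z : Ω × (Fin (n + 1) → Ω) =>
        A z.1 (prodApply A f n z.2)) ∘
          MeasurableEquiv.piFinSuccAbove (fun _ : Fin (n + 2) => Ω) (Fin.last (n + 1)) := by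
      funext w
      simp [prodApply, MeasurableEquiv.piFinSuccAbove, Fin.insertNthEquiv, Fin.init_def]
    have hint : Integrable (fun z : Ω × (Fin (n + 1) → Ω) => A z.1 (prodApply A f n z.2))
        (p.prod (Measure.pi fun _ => p)) :=
      hA.op_fst_snd (op := fun (T : Op d) (v : Evec d) => T v)
        isBoundedBilinearMap_apply.continuous
        ⟨1, fun T v => by simpa using T.le_opNorm v⟩ ih.1
    refine ⟨hcomp ▸ hmp.integrable_comp_of_integrable hint, ?_⟩
    rw [hcomp]
    simp only [Function.comp_apply]
    rw [hmp.integral_comp' (g := fun z : Ω × (Fin (n + 1) → Ω) => A z.1 (prodApply A f n z.2))]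
    refine (integral_prod_bilin (ContinuousLinearMap.id ℂ (Op d)) hA ih.1).trans ?_
    rw [ih.2, pow_succ', mul_apply_eq_comp]
    rfl

theorem measurable_cesaroProj (hMmeas : Measurable M) {C : ℝ}
    (hC : ∀ T ∈ contractionsFixing Nrm ψS, ‖T‖ ≤ C)
    (hM : ∀ ω, M ω ∈ contractionsFixing Nrm ψS) : Measurable fun ω => cesaroProj (M ω) := by
  refine measurable_of_tendsto_metrizable (f := fun (N : ℕ) ω =>
    (N : ℂ)⁻¹ • ∑ k ∈ Finset.range N, M ω ^ k) (fun N => ?_)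
    (tendsto_pi_nhds.2 fun ω => (cesaroProj_spec hC (hM ω)).1)
  have : Continuous fun T : Op d => (N : ℂ)⁻¹ • ∑ k ∈ Finset.range N, T ^ k := by fun_prop
  exact this.measurable.comp hMmeas

theorem integrable_psiOf (hMmeas : Measurable M) {C : ℝ}
    (hC : ∀ T ∈ contractionsFixing Nrm ψS, ‖T‖ ≤ C) (hψS : ‖ψS‖ = 1)
    (hM : ∀ ω, M ω ∈ contractionsFixing Nrm ψS) : Integrable (fun ω => psiOf ψS (M ω)) p := by
  have hc : Continuous fun T : Op d => adjoint T ψS := by fun_prop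
  exact Integrable.of_bound
    (hc.measurable.comp (measurable_cesaroProj hMmeas hC hM)).aestronglyMeasurable C
    (Eventually.of_forall fun ω => norm_psiOf_le hC hψS (hM ω))

/-- `E[M_Q]^* = E[M]^* - |E[ψ]⟩⟨ψ_S|`. -/
theorem adjoint_integral_MQof_apply (hMmeas : Measurable M) (hMint : Integrable M p) {C : ℝ}
    (hC : ∀ T ∈ contractionsFixing Nrm ψS, ‖T‖ ≤ C) (hψS : ‖ψS‖ = 1)
    (hM : ∀ ω, M ω ∈ contractionsFixing Nrm ψS) (v : Evec d) :
    adjoint (∫ ω, MQof ψS (M ω) ∂p) v =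
      adjoint (∫ ω, M ω ∂p) v - inner ℂ ψS v • ∫ ω, psiOf ψS (M ω) ∂p := by
  have hψint := integrable_psiOf (p := p) hMmeas hC hψS hM
  have hket : Continuous fun u : Evec d => ketBra ψS u := by
    unfold ketBra
    fun_prop
  have hketint : Integrable (fun ω => ketBra ψS (psiOf ψS (M ω))) p := by
    refine hψint.norm.mono' (hket.comp_aestronglyMeasurable hψint.1)
      (Eventually.of_forall fun ω => ?_)
    simp [ketBra, norm_smulRight_apply, hψS]
  simp only [MQof_eq_s11 hC hψS (hM _)]
  rw [integral_sub hMint hketint, map_sub, sub_apply, ← adjoint_integral hketint,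
    integral_apply (((adjoint : Op d ≃ₗᵢ⋆[ℂ] Op d).integrable_comp_iff).2 hketint),
    ← integral_smul]
  congr 2
  funext ω
  refine ext_inner_right ℂ fun x => ?_
  rw [adjoint_inner_left]
  simp [ketBra, inner_smul_left, inner_smul_right, mul_comm]

/-- A telescoping identity for a map `R` that differs from `N` by a rank-one perturbation. -/
theorem pow_apply_eq_sum_pow_apply {d : ℕ} {N R : Op d} {ψS φ : Evec d}
    (hR : ∀ v, R v = N v - inner ℂ ψS v • φ) (hφ : inner ℂ ψS φ = 1)
    (hN : ∀ v, inner ℂ ψS (N v) = inner ℂ ψS v) (n : ℕ) :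
    (N ^ n) φ = ∑ k ∈ Finset.range (n + 1), (R ^ k) φ := by
  have horth : ∀ k : ℕ, inner ℂ ψS ((R ^ (k + 1)) φ) = 0 := fun k => by
    rw [pow_succ', mul_apply_eq_comp, hR, inner_sub_right, inner_smul_right, hφ, hN, mul_one,
      sub_self]
  have hsum : ∀ n : ℕ, inner ℂ ψS (∑ k ∈ Finset.range (n + 1), (R ^ k) φ) = 1 := fun n => by
    rw [Finset.sum_range_succ', inner_add_right, inner_sum, Finset.sum_eq_zero fun k _ => horth k,
      zero_add, pow_zero, one_apply_eq_self, hφ]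
  induction n with
  | zero => simp
  | succ n ih =>
    have h := hR (∑ k ∈ Finset.range (n + 1), (R ^ k) φ)
    rw [hsum, one_smul, map_sum] at h
    rw [pow_succ', mul_apply_eq_comp, ih, sub_eq_iff_eq_add.1 h.symm,
      Finset.sum_range_succ' _ (n + 1), pow_zero, one_apply_eq_self]
    simp only [pow_succ', mul_apply_eq_comp]

theorem prod_ofFn_apply_eq_prodApply {d : ℕ} {Ω : Type*} (A : Ω → Op d) (f : Ω → Evec d) (n : ℕ)
    (w : ℕ → Ω) :
    ((List.ofFn fun i : Fin n => A (w (n - i))).prod) (f (w 0)) =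
      prodApply A f n fun i => w i := by
  induction n with
  | zero => simp [prodApply]
  | succ n ih =>
    rw [List.ofFn_succ, List.prod_cons, mul_apply_eq_comp]
    simp only [Fin.val_succ, Nat.add_sub_add_right, ih]
    rfl

theorem integral_prodApply_eq {A : Ω → Op d} {f : Ω → Evec d} (hA : Integrable A p)
    (hf : Integrable f p) {Pb : Measure (ℕ → Ω)}
    (hPb : ∀ n : ℕ, Pb.map (fun ωb (i : Fin n) => ωb i) = Measure.pi fun _ : Fin n => p) (n : ℕ) :
    ∫ ωb, prodApply A f n (fun i => ωb i) ∂Pb = ((∫ ω, A ω ∂p) ^ n) (∫ ω, f ω ∂p) := by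
  obtain ⟨hint, heq⟩ := integrable_prodApply_and_integral_eq hA hf n
  rw [← heq, ← hPb (n + 1), integral_map
    (measurable_pi_lambda _ fun _ => measurable_pi_apply _).aemeasurable
    (by rw [hPb]; exact hint.1)]

end Expectation

/-- `E[θ_n] = Σ_{k=0}^{n-1} (E[M_Q]^*)^k E[ψ]` and
`E[θ_n] → P_{1,E[M]}^* ψ_S`.  Here `ω̄ = (ω̄ 0, ω̄ 1, …)` stands for `(ω_1, ω_2, …)`, and
`θ_n(ω̄) = M(ω_n)^* ⋯ M(ω_2)^* ψ(ω_1)`; `Pb` is the infinite product measure,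
characterized by its finite-dimensional marginals. -/
theorem stmt11 {d : ℕ} (hd : 1 ≤ d) {Ω : Type*} [MeasurableSpace Ω]
    (p : Measure Ω) [IsProbabilityMeasure p]
    (M : Ω → Op d) (hMmeas : Measurable M)
    (Nrm : Seminorm ℂ (Evec d)) (hNrm : ∀ x, Nrm x = 0 → x = 0)
    (hcontr : ∀ (ω : Ω) (x : Evec d), Nrm (M ω x) ≤ Nrm x)
    (ψS : Evec d) (hψS : ‖ψS‖ = 1) (hfix : ∀ ω, M ω ψS = ψS)
    (Pb : Measure (ℕ → Ω)) [IsProbabilityMeasure Pb]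
    (hPb : ∀ n : ℕ, Pb.map (fun ωb (i : Fin n) => ωb i) = Measure.pi fun _ : Fin n => p)
    (hpos : 0 < p {ω | mcalE ψS (M ω)})
    (θ : ℕ → (ℕ → Ω) → Evec d)
    (hθ : ∀ (n : ℕ) (ωb : ℕ → Ω), θ n ωb =
      ((List.ofFn fun i : Fin (n - 1) => adjoint (M (ωb (n - 1 - i)))).prod)
        (psiOf ψS (M (ωb 0)))) :
    (∀ n : ℕ, 1 ≤ n →
      ∫ ωb, θ n ωb ∂Pb =
        ∑ k ∈ Finset.range n,
          ((adjoint (∫ ω, MQof ψS (M ω) ∂p)) ^ k) (∫ ω, psiOf ψS (M ω) ∂p)) ∧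
    Tendsto (fun n : ℕ => ∫ ωb, θ n ωb ∂Pb) atTop
      (nhds (adjoint (cesaroProj (∫ ω, M ω ∂p)) ψS)) := by
  obtain ⟨a, b, ha0, hb0, ha, hb⟩ := Nrm.exists_bounds hNrm
  have hC : ∀ T ∈ contractionsFixing Nrm ψS, ‖T‖ ≤ b * a := fun T =>
    norm_le_of_mem_contractionsFixing hb0.le ha0.le ha hb
  have hM : ∀ ω, M ω ∈ contractionsFixing Nrm ψS := fun ω => ⟨hcontr ω, hfix ω⟩
  have : ProperSpace (Op d) := FiniteDimensional.proper ℂ _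
  have hMint : Integrable M p := Integrable.of_bound hMmeas.aestronglyMeasurable (b * a)
    (Eventually.of_forall fun ω => hC _ (hM ω))
  have hN : ∫ ω, M ω ∂p ∈ contractionsFixing Nrm ψS :=
    convex_contractionsFixing.integral_mem isClosed_contractionsFixing (Eventually.of_forall hM)
      hMint
  have hψint : Integrable (fun ω => psiOf ψS (M ω)) p := integrable_psiOf hMmeas hC hψS hM
  set φ := ∫ ω, psiOf ψS (M ω) ∂p with hφ
  have hφ1 : inner ℂ ψS φ = 1 := by
    rw [hφ, ← integral_inner hψint]
    have h : ∀ ω, inner ℂ ψS (psiOf ψS (M ω)) = (1 : ℂ) := fun ω => by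
      rw [← inner_conj_symm, inner_psiOf_s11 hC hψS (hM ω), map_one]
    simp [h]
  have hθint : ∀ n : ℕ, ∫ ωb, θ (n + 1) ωb ∂Pb = (adjoint (∫ ω, M ω ∂p) ^ n) φ := fun n => by
    have h : ∀ ωb, θ (n + 1) ωb = prodApply (fun ω => adjoint (M ω)) (fun ω => psiOf ψS (M ω)) n
        fun i => ωb i := fun ωb =>
      (hθ (n + 1) ωb).trans (prod_ofFn_apply_eq_prodApply
        (fun ω => adjoint (M ω)) (fun ω => psiOf ψS (M ω)) n ωb)
    simp only [h]
    rw [integral_prodApply_eq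
      (((adjoint : Op d ≃ₗᵢ⋆[ℂ] Op d).integrable_comp_iff).2 hMint) hψint hPb,
      adjoint_integral hMint]
  constructor
  · intro n hn
    obtain ⟨n, rfl⟩ := Nat.exists_eq_add_of_le' hn
    rw [hθint]
    exact pow_apply_eq_sum_pow_apply (adjoint_integral_MQof_apply hMmeas hMint hC hψS hM) hφ1
      (fun v => by rw [adjoint_inner_right, hN.2]) n
  · rw [← tendsto_add_atTop_iff_nat 1]
    simp only [hθint]
    have hfixed : ∀ n : ℕ, (adjoint (∫ ω, M ω ∂p) ^ n) (psiOf ψS (∫ ω, M ω ∂p)) =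
        psiOf ψS (∫ ω, M ω ∂p) := fun n => by
      induction n with
      | zero => simp
      | succ n ih => rw [pow_succ, mul_apply_eq_comp, adjoint_psiOf hC hN, ih]
    have hy : inner ℂ (φ - psiOf ψS (∫ ω, M ω ∂p)) ψS = 0 := by
      rw [inner_sub_left, inner_psiOf_s11 hC hψS hN, ← inner_conj_symm, hφ1, map_one, sub_self]
    have h := (tendsto_adjoint_integral_pow hMmeas hMint hM hNrm hψS hpos hy).add_const
      (psiOf ψS (∫ ω, M ω ∂p))
    simp only [map_sub, hfixed, sub_add_cancel, zero_add] at h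
    exact h
end
end
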